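/- arXiv:1909.11705 — 2 statements merged into one kernel-verified Lean document; each statement's English description precedes it below -/
import Mathlib

section
/- The space of quadratic relations among the generalized 2×2 permanents has dimension dim_ℂ (ker Ψ̄)_2 = binom(m+3,4)·(n²(n²−1)/12) + (m²(m²−1)/12)·binom(n+3,4). -/
open MvPolynomial

/-- Index set for the generalized 2×2 permanents of a generic `m × n` matrix:
quadruples `((i,i'),(j,j'))` with `i ≤ i'` and `j ≤ j'`. -/
def PermIdx (m n : ℕ) : Type :=
  {w : (Fin m × Fin m) × (Fin n × Fin n) // w.1.1 ≤ w.1.2 ∧ w.2.1 ≤ w.2.2}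

/-- The generalized 2×2 permanent
`p_{(i,i'),(j,j')} = x_{i,j} x_{i',j'} + x_{i,j'} x_{i',j}`. -/
noncomputable def perm {m n : ℕ} (w : PermIdx m n) : MvPolynomial (Fin m × Fin n) ℂ :=
  X (w.1.1.1, w.1.2.1) * X (w.1.1.2, w.1.2.2) + X (w.1.1.1, w.1.2.2) * X (w.1.1.2, w.1.2.1)

/-- The ℂ-algebra map `Ψ̄ : R̄ → S` sending `ȳ_w` to the corresponding permanent. -/
noncomputable def PsiBar (m n : ℕ) :
    MvPolynomial (PermIdx m n) ℂ →ₐ[ℂ] MvPolynomial (Fin m × Fin n) ℂ :=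
  aeval perm

/-- The degree `d` graded component of `ker Ψ̄`, as a ℂ-subspace of `R̄`. -/
noncomputable def kerPsiBarDeg (m n d : ℕ) : Submodule ℂ (MvPolynomial (PermIdx m n) ℂ) :=
  Submodule.restrictScalars ℂ (RingHom.ker (PsiBar m n)) ⊓
    homogeneousSubmodule (PermIdx m n) ℂ d


/-- quadruples -/
abbrev Q4 (α : Type) := α × α × α × α

/-- The eight elements of the dihedral group preserving the pairing `12|34`. -/
def gD {α : Type} (j : Fin 8) (x : Q4 α) : Q4 α :=
  (![(x.1, x.2.1, x.2.2.1, x.2.2.2), (x.2.1, x.1, x.2.2.1, x.2.2.2),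
     (x.1, x.2.1, x.2.2.2, x.2.2.1), (x.2.1, x.1, x.2.2.2, x.2.2.1),
     (x.2.2.1, x.2.2.2, x.1, x.2.1), (x.2.2.2, x.2.2.1, x.1, x.2.1),
     (x.2.2.1, x.2.2.2, x.2.1, x.1), (x.2.2.2, x.2.2.1, x.2.1, x.1)] : Fin 8 → Q4 α) j

/-- Coset representatives. -/
def sK {α : Type} (k : Fin 3) (x : Q4 α) : Q4 α :=
  (![(x.1, x.2.1, x.2.2.1, x.2.2.2), (x.1, x.2.2.1, x.2.1, x.2.2.2),
     (x.1, x.2.2.2, x.2.2.1, x.2.1)] : Fin 3 → Q4 α) k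

noncomputable def opD {α : Type} (F : Q4 α → ℂ) (x : Q4 α) : ℂ := (1 / 8) * ∑ j, F (gD j x)

noncomputable def opE {α : Type} (F : Q4 α → ℂ) (x : Q4 α) : ℂ :=
  (1 / 24) * ∑ k, ∑ j, F (gD j (sK k x))

lemma opD_1 {α : Type} (F : Q4 α → ℂ) (a b c d : α) : opD F (b, a, c, d) = opD F (a, b, c, d) := by
  simp [opD, Fin.sum_univ_succ, gD]; ring

lemma opD_2 {α : Type} (F : Q4 α → ℂ) (a b c d : α) : opD F (c, d, a, b) = opD F (a, b, c, d) := by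
  simp [opD, Fin.sum_univ_succ, gD]; ring

lemma opE_1 {α : Type} (F : Q4 α → ℂ) (a b c d : α) : opE F (b, a, c, d) = opE F (a, b, c, d) := by
  simp [opE, Fin.sum_univ_succ, gD, sK]; ring

lemma opE_2 {α : Type} (F : Q4 α → ℂ) (a b c d : α) : opE F (c, d, a, b) = opE F (a, b, c, d) := by
  simp [opE, Fin.sum_univ_succ, gD, sK]; ring

lemma opE_3 {α : Type} (F : Q4 α → ℂ) (a b c d : α) : opE F (a, c, b, d) = opE F (a, b, c, d) := by
  simp [opE, Fin.sum_univ_succ, gD, sK]; ring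

lemma opE_4 {α : Type} (F : Q4 α → ℂ) (a b c d : α) : opE F (a, d, c, b) = opE F (a, b, c, d) := by
  simp [opE, Fin.sum_univ_succ, gD, sK]; ring

lemma opD_sum {α : Type} (F : Q4 α → ℂ) (a b c d : α) :
    opD F (a, b, c, d) + opD F (a, c, b, d) + opD F (a, d, c, b) = 3 * opE F (a, b, c, d) := by
  simp [opE, opD, Fin.sum_univ_succ, gD, sK]; ring

lemma opE_add {α : Type} (F G H : Q4 α → ℂ) (h : ∀ x, F x + G x + H x = 0) (x : Q4 α) :
    opE F x + opE G x + opE H x = 0 := by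
  simp only [opE, ← mul_add, ← Finset.sum_add_distrib, h]; simp

/-- The space of tensors corresponding to quadratic relations. -/
def KT (α β : Type) : Submodule ℂ (Q4 α × Q4 β → ℂ) where
  carrier := {T | (∀ a b c d y, T ((b, a, c, d), y) = T ((a, b, c, d), y)) ∧
    (∀ x p q r s, T (x, (q, p, r, s)) = T (x, (p, q, r, s))) ∧
    (∀ a b c d p q r s, T ((c, d, a, b), (r, s, p, q)) = T ((a, b, c, d), (p, q, r, s))) ∧
    (∀ a b c d p q r s, T ((a, b, c, d), (p, q, r, s)) + T ((a, c, b, d), (p, r, q, s)) +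
      T ((a, d, c, b), (p, s, r, q)) = 0)}
  zero_mem' := by simp
  add_mem' := by
    rintro T U ⟨h1, h2, h3, h4⟩ ⟨k1, k2, k3, k4⟩
    refine ⟨?_, ?_, ?_, ?_⟩
    · intro a b c d y; simp only [Pi.add_apply, h1 a, k1 a]
    · intro x p q r s; simp only [Pi.add_apply, h2 x p, k2 x p]
    · intro a b c d p q r s; simp only [Pi.add_apply, h3 a b c d, k3 a b c d]
    · intro a b c d p q r s; simp only [Pi.add_apply]
      linear_combination h4 a b c d p q r s + k4 a b c d p q r s
  smul_mem' := by
    rintro z T ⟨h1, h2, h3, h4⟩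
    refine ⟨?_, ?_, ?_, ?_⟩
    · intro a b c d y; simp only [Pi.smul_apply, h1 a]
    · intro x p q r s; simp only [Pi.smul_apply, h2 x p]
    · intro a b c d p q r s; simp only [Pi.smul_apply, h3 a b c d]
    · intro a b c d p q r s; simp only [Pi.smul_apply, smul_eq_mul]
      linear_combination z * h4 a b c d p q r s

noncomputable def opPi (α β : Type) : (Q4 α × Q4 β → ℂ) →ₗ[ℂ] (Q4 α × Q4 β → ℂ) :=
  (1 / 192 : ℂ) • ∑ k : Fin 3, ∑ j : Fin 8, ∑ l : Fin 8,
      LinearMap.funLeft ℂ ℂ (Prod.map (gD j ∘ sK k) (gD l)) +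
  (1 / 192 : ℂ) • ∑ k : Fin 3, ∑ j : Fin 8, ∑ l : Fin 8,
      LinearMap.funLeft ℂ ℂ (Prod.map (gD l) (gD j ∘ sK k)) -
  (2 / 576 : ℂ) • ∑ k : Fin 3, ∑ j : Fin 8, ∑ k' : Fin 3, ∑ j' : Fin 8,
      LinearMap.funLeft ℂ ℂ (Prod.map (gD j ∘ sK k) (gD j' ∘ sK k'))

lemma opPi_apply {α β : Type} (T : Q4 α × Q4 β → ℂ) (x : Q4 α) (y : Q4 β) :
    opPi α β T (x, y) =
      opE (fun x' => opD (fun y' => T (x', y')) y - opE (fun y' => T (x', y')) y) x +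
      opE (fun y' => opD (fun x' => T (x', y')) x - opE (fun x' => T (x', y')) x) y := by
  have hE : opE (fun y' => opE (fun x' => T (x', y')) x) y =
      opE (fun x' => opE (fun y' => T (x', y')) y) x := by
    have key : ∀ {γ : Type} (F : Q4 γ → ℂ) z,
        opE F z = (1 / 24) * ∑ i : Fin 3 × Fin 8, F (gD i.2 (sK i.1 z)) := by
      intro γ F z; rw [Fintype.sum_prod_type]; rfl
    simp only [key, Finset.mul_sum]
    rw [Finset.sum_comm]
  have hsub : ∀ {γ : Type} (F G : Q4 γ → ℂ) z, opE (fun x' => F x' - G x') z =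
      opE F z - opE G z := by
    intro γ F G z; simp only [opE, Finset.sum_sub_distrib, mul_sub]
  rw [hsub, hsub, hE]
  simp only [opPi, LinearMap.add_apply, LinearMap.sub_apply, LinearMap.smul_apply,
    LinearMap.sum_apply, Pi.add_apply, Pi.sub_apply, Pi.smul_apply, Finset.sum_apply,
    LinearMap.funLeft_apply, Prod.map_apply, smul_eq_mul, Function.comp_apply]
  have e1 : opE (fun x' => opD (fun y' => T (x', y')) y) x = (1 / 192 : ℂ) *
      ∑ k : Fin 3, ∑ j : Fin 8, ∑ l : Fin 8, T (gD j (sK k x), gD l y) := by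
    simp only [opE, opD, Finset.mul_sum]
    refine Finset.sum_congr rfl fun _ _ => Finset.sum_congr rfl fun _ _ =>
      Finset.sum_congr rfl fun _ _ => ?_
    ring
  have e2 : opE (fun y' => opD (fun x' => T (x', y')) x) y = (1 / 192 : ℂ) *
      ∑ k : Fin 3, ∑ j : Fin 8, ∑ l : Fin 8, T (gD l x, gD j (sK k y)) := by
    simp only [opE, opD, Finset.mul_sum]
    refine Finset.sum_congr rfl fun _ _ => Finset.sum_congr rfl fun _ _ =>
      Finset.sum_congr rfl fun _ _ => ?_
    ring
  have e3 : opE (fun x' => opE (fun y' => T (x', y')) y) x = (1 / 576 : ℂ) *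
      ∑ k : Fin 3, ∑ j : Fin 8, ∑ k' : Fin 3, ∑ j' : Fin 8,
        T (gD j (sK k x), gD j' (sK k' y)) := by
    simp only [opE, Finset.mul_sum]
    refine Finset.sum_congr rfl fun _ _ => Finset.sum_congr rfl fun _ _ =>
      Finset.sum_congr rfl fun _ _ => Finset.sum_congr rfl fun _ _ => ?_
    ring
  rw [e1, e2, e3]; ring

lemma opPi_mem {α β : Type} (T : Q4 α × Q4 β → ℂ) : opPi α β T ∈ KT α β := by
  refine ⟨?_, ?_, ?_, ?_⟩
  · intro a b c d y; simp only [opPi_apply, opE_1 _ a b, opD_1 _ a b]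
  · intro x a b c d; simp only [opPi_apply, opE_1 _ a b, opD_1 _ a b]
  · intro a b c d p q r s
    simp only [opPi_apply, opE_2 _ a b, opD_2 _ a b, opE_2 _ p q, opD_2 _ p q]
  · intro a b c d p q r s
    simp only [opPi_apply]
    rw [opE_3 _ a b c d, opE_4 _ a b c d, opE_3 _ p q r s, opE_4 _ p q r s]
    have k1 := opE_add
      (fun x' => opD (fun y' => T (x', y')) (p, q, r, s) - opE (fun y' => T (x', y')) (p, q, r, s))
      (fun x' => opD (fun y' => T (x', y')) (p, r, q, s) - opE (fun y' => T (x', y')) (p, r, q, s))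
      (fun x' => opD (fun y' => T (x', y')) (p, s, r, q) - opE (fun y' => T (x', y')) (p, s, r, q))
      (fun x' => by
        rw [opE_3 _ p q r s, opE_4 _ p q r s]
        linear_combination opD_sum (fun y' => T (x', y')) p q r s) (a, b, c, d)
    have k2 := opE_add
      (fun y' => opD (fun x' => T (x', y')) (a, b, c, d) - opE (fun x' => T (x', y')) (a, b, c, d))
      (fun y' => opD (fun x' => T (x', y')) (a, c, b, d) - opE (fun x' => T (x', y')) (a, c, b, d))
      (fun y' => opD (fun x' => T (x', y')) (a, d, c, b) - opE (fun x' => T (x', y')) (a, d, c, b))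
      (fun y' => by
        rw [opE_3 _ a b c d, opE_4 _ a b c d]
        linear_combination opD_sum (fun x' => T (x', y')) a b c d) (p, q, r, s)
    linear_combination k1 + k2

lemma opD_of {α : Type} (F : Q4 α → ℂ) (h1 : ∀ a b c d, F (b, a, c, d) = F (a, b, c, d))
    (h2 : ∀ a b c d, F (c, d, a, b) = F (a, b, c, d)) (j : Fin 8) (x : Q4 α) :
    F (gD j x) = F x := by
  obtain ⟨a, b, c, d⟩ := x
  have h3 : ∀ a b c d, F (a, b, d, c) = F (a, b, c, d) := by
    intro a b c d; rw [← h2, h1, h2]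
  fin_cases j <;> simp [gD]
  · rw [h1]
  · rw [h3]
  · rw [h1, h3]
  · rw [h2]
  · rw [h1, h2]
  · rw [h3, h2]
  · rw [h1, h3, h2]

lemma opPi_id {α β : Type} (T : Q4 α × Q4 β → ℂ) (hT : T ∈ KT α β) : opPi α β T = T := by
  obtain ⟨h1, h2, h3, h4⟩ := hT
  have h1' : ∀ a b c d y, T ((a, b, d, c), y) = T ((a, b, c, d), y) := by
    rintro a b c d ⟨p, q, r, s⟩; rw [← h3, h1, h3]
  have h2' : ∀ x p q r s, T (x, (p, q, s, r)) = T (x, (p, q, r, s)) := by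
    rintro ⟨a, b, c, d⟩ p q r s; rw [← h3, h2, h3]
  have h5 : ∀ a b c d p q r s, T ((a, b, c, d), (r, s, p, q)) = T ((a, b, c, d), (p, q, r, s)) := by
    intro a b c d p q r s
    have e1 := h4 a b c d p q r s
    have e2 := h4 a b c d q p s r
    have e3 := h4 a b c d r s p q
    have e4 := h4 a b c d s r q p
    have f2 : T ((a, b, c, d), (q, p, s, r)) = T ((a, b, c, d), (p, q, r, s)) := by
      rw [h2, h2']
    have f4 : T ((a, b, c, d), (s, r, q, p)) = T ((a, b, c, d), (r, s, p, q)) := by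
      rw [h2, h2']
    have g3 : T ((a, c, b, d), (r, p, s, q)) = T ((a, c, b, d), (p, r, q, s)) := by
      rw [h2, h2']
    have g4 : T ((a, c, b, d), (s, q, r, p)) = T ((a, c, b, d), (q, s, p, r)) := by
      rw [h2, h2']
    have k3 : T ((a, d, c, b), (s, p, q, r)) = T ((a, d, c, b), (p, s, r, q)) := by
      rw [h2, h2']
    have k4 : T ((a, d, c, b), (q, r, s, p)) = T ((a, d, c, b), (r, q, p, s)) := by
      rw [h2, h2']
    rw [f2, k4] at e2
    rw [g3] at e3
    rw [f4, g4, k3] at e4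
    linear_combination (1 / 2) * (e3 + e4 - e1 - e2)
  have h6 : ∀ a b c d p q r s, T ((c, d, a, b), (p, q, r, s)) = T ((a, b, c, d), (p, q, r, s)) := by
    intro a b c d p q r s
    rw [h5 c d a b r s p q, h3]
  have hx : ∀ j x y, T (gD j x, y) = T (x, y) := by
    rintro j x ⟨p, q, r, s⟩
    exact opD_of (fun x => T (x, (p, q, r, s))) (fun a b c d => h1 _ _ _ _ _)
      (fun a b c d => h6 _ _ _ _ _ _ _ _) j x
  have hy : ∀ j x y, T (x, gD j y) = T (x, y) := by
    rintro j ⟨p, q, r, s⟩ y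
    exact opD_of (fun y => T ((p, q, r, s), y)) (fun a b c d => h2 _ _ _ _ _)
      (fun a b c d => h5 _ _ _ _ _ _ _ _) j y
  funext ⟨⟨a, b, c, d⟩, ⟨p, q, r, s⟩⟩
  rw [opPi_apply]
  simp only [opE, opD, hx, hy]
  have r1 := h4 a b c d p q r s
  have r2 := h4 a b c d p r q s
  have r3 := h4 a b c d p s r q
  have r4 := h4 a b c d p q s r
  have r5 := h4 a b c d p r s q
  have r6 := h4 a b c d p s q r
  rw [h2' (a, d, c, b) p s r q] at r2
  rw [h2' (a, c, b, d) p r q s] at r3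
  rw [h2' (a, b, c, d) p q r s, h2' (a, c, b, d) p s r q, h2' (a, d, c, b) p r q s] at r4
  rw [h2' (a, b, c, d) p r q s, h2' (a, d, c, b) p q r s] at r5
  rw [h2' (a, b, c, d) p s r q, h2' (a, c, b, d) p q r s] at r6
  simp [Fin.sum_univ_succ, sK]
  linear_combination -(1 / 3) * (r1 + r4) + (1 / 18) * (r1 + r2 + r3 + r4 + r5 + r6)

lemma trace_funLeft {ι : Type} [Fintype ι] [DecidableEq ι] (f : ι → ι) :
    LinearMap.trace ℂ _ (LinearMap.funLeft ℂ ℂ f) = ∑ x, if f x = x then (1 : ℂ) else 0 := by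
  rw [LinearMap.trace_eq_matrix_trace ℂ (Pi.basisFun ℂ ι), Matrix.trace]
  refine Finset.sum_congr rfl fun x _ => ?_
  simp [LinearMap.toMatrix_apply, LinearMap.funLeft_apply, Pi.single_apply]

lemma trace_prod {ι κ : Type} [Fintype ι] [DecidableEq ι] [Fintype κ] [DecidableEq κ]
    (f : ι → ι) (g : κ → κ) :
    LinearMap.trace ℂ _ (LinearMap.funLeft ℂ ℂ (Prod.map f g)) =
      (∑ x, if f x = x then (1 : ℂ) else 0) * ∑ x, if g x = x then (1 : ℂ) else 0 := by
  rw [trace_funLeft, Fintype.sum_prod_type, Finset.sum_mul_sum]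
  refine Finset.sum_congr rfl fun x _ => Finset.sum_congr rfl fun y _ => ?_
  simp [Prod.ext_iff, ← ite_and, and_comm]

def cyc (k : Fin 3) (j : Fin 8) : ℕ :=
  (![![4, 3, 3, 2, 2, 1, 1, 2], ![3, 2, 2, 1, 1, 2, 2, 3], ![3, 2, 2, 1, 3, 2, 2, 1]] :
    Fin 3 → Fin 8 → ℕ) k j

lemma fix1 (m : ℕ) (k : Fin 3) (j : Fin 8) : (∑ x : Q4 (Fin m),
    if (gD j ∘ sK k) x = x then (1 : ℂ) else 0) = (m : ℂ) ^ cyc k j := by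
  have hs : ∀ (p : Prop) [Decidable p] (f : Fin m → ℂ),
      (∑ x, if p then f x else 0) = if p then ∑ x, f x else 0 := by
    intro p _ f; split_ifs <;> simp
  simp only [Fintype.sum_prod_type]
  fin_cases k <;> fin_cases j <;>
    simp [gD, sK, cyc, ite_and, hs, -Finset.sum_boole] <;> ring_nf

lemma fixD (m : ℕ) : (∑ j : Fin 8, ∑ x : Q4 (Fin m), if gD j x = x then (1 : ℂ) else 0) =
    m ^ 4 + 2 * m ^ 3 + 3 * m ^ 2 + 2 * m := by
  have : ∀ j : Fin 8, (∑ x : Q4 (Fin m), if gD j x = x then (1 : ℂ) else 0) =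
      (m : ℂ) ^ cyc 0 j := fun j => fix1 m 0 j
  simp only [this]
  simp [Fin.sum_univ_succ, cyc]
  ring

lemma fixE (m : ℕ) : (∑ k : Fin 3, ∑ j : Fin 8, ∑ x : Q4 (Fin m),
    if (gD j ∘ sK k) x = x then (1 : ℂ) else 0) =
    m ^ 4 + 6 * m ^ 3 + 11 * m ^ 2 + 6 * m := by
  simp only [fix1]
  simp [Fin.sum_univ_succ, cyc]
  ring

lemma trace_opPi (m n : ℕ) : LinearMap.trace ℂ _ (opPi (Fin m) (Fin n)) =
    (1 / 192) * ((m ^ 4 + 6 * m ^ 3 + 11 * m ^ 2 + 6 * m) * (n ^ 4 + 2 * n ^ 3 + 3 * n ^ 2 + 2 * n))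
    + (1 / 192) * ((m ^ 4 + 2 * m ^ 3 + 3 * m ^ 2 + 2 * m) * (n ^ 4 + 6 * n ^ 3 + 11 * n ^ 2 + 6 * n))
    - (2 / 576) *
      ((m ^ 4 + 6 * m ^ 3 + 11 * m ^ 2 + 6 * m) * (n ^ 4 + 6 * n ^ 3 + 11 * n ^ 2 + 6 * n)) := by
  simp only [opPi, map_add, map_sub, map_smul, map_sum, trace_prod, smul_eq_mul]
  rw [← fixE m, ← fixE n, ← fixD m, ← fixD n]
  generalize hA : (fun (k : Fin 3) (j : Fin 8) => ∑ x : Q4 (Fin m),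
    if (gD j ∘ sK k) x = x then (1 : ℂ) else 0) = A
  generalize hB : (fun (k : Fin 3) (j : Fin 8) => ∑ x : Q4 (Fin n),
    if (gD j ∘ sK k) x = x then (1 : ℂ) else 0) = B
  generalize hC : (fun (j : Fin 8) => ∑ x : Q4 (Fin m),
    if gD j x = x then (1 : ℂ) else 0) = C
  generalize hD : (fun (j : Fin 8) => ∑ x : Q4 (Fin n),
    if gD j x = x then (1 : ℂ) else 0) = D
  have hA' : ∀ k j, (∑ x : Q4 (Fin m), if (gD j ∘ sK k) x = x then (1 : ℂ) else 0) = A k j :=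
    fun k j => congrFun (congrFun hA k) j
  have hB' : ∀ k j, (∑ x : Q4 (Fin n), if (gD j ∘ sK k) x = x then (1 : ℂ) else 0) = B k j :=
    fun k j => congrFun (congrFun hB k) j
  have hC' : ∀ j, (∑ x : Q4 (Fin m), if gD j x = x then (1 : ℂ) else 0) = C j :=
    fun j => congrFun hC j
  have hD' : ∀ j, (∑ x : Q4 (Fin n), if gD j x = x then (1 : ℂ) else 0) = D j :=
    fun j => congrFun hD j
  simp only [hA', hB', hC', hD']
  have e2 : ∑ k, ∑ j, ∑ l, C l * B k j = (∑ l, C l) * ∑ k, ∑ j, B k j := by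
    simp only [← Finset.sum_mul, ← Finset.mul_sum]
  rw [e2]
  simp only [← Finset.sum_mul, ← Finset.mul_sum]

lemma finrank_KT (m n : ℕ) : (Module.finrank ℂ (KT (Fin m) (Fin n)) : ℂ) =
    (1 / 192) * ((m ^ 4 + 6 * m ^ 3 + 11 * m ^ 2 + 6 * m) * (n ^ 4 + 2 * n ^ 3 + 3 * n ^ 2 + 2 * n))
    + (1 / 192) * ((m ^ 4 + 2 * m ^ 3 + 3 * m ^ 2 + 2 * m) * (n ^ 4 + 6 * n ^ 3 + 11 * n ^ 2 + 6 * n))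
    - (2 / 576) *
      ((m ^ 4 + 6 * m ^ 3 + 11 * m ^ 2 + 6 * m) * (n ^ 4 + 6 * n ^ 3 + 11 * n ^ 2 + 6 * n)) := by
  rw [← trace_opPi]
  exact (LinearMap.IsProj.trace (p := KT (Fin m) (Fin n)) (f := opPi (Fin m) (Fin n))
    ⟨fun T => opPi_mem T, fun T hT => opPi_id T hT⟩ ).symm

lemma final_arith (m n N : ℕ) (hm : 1 ≤ m) (hn : 1 ≤ n) (h : (N : ℂ) =
    (1 / 192) * ((m ^ 4 + 6 * m ^ 3 + 11 * m ^ 2 + 6 * m) * (n ^ 4 + 2 * n ^ 3 + 3 * n ^ 2 + 2 * n))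
    + (1 / 192) * ((m ^ 4 + 2 * m ^ 3 + 3 * m ^ 2 + 2 * m) * (n ^ 4 + 6 * n ^ 3 + 11 * n ^ 2 + 6 * n))
    - (2 / 576) *
      ((m ^ 4 + 6 * m ^ 3 + 11 * m ^ 2 + 6 * m) * (n ^ 4 + 6 * n ^ 3 + 11 * n ^ 2 + 6 * n))) :
    N = Nat.choose (m + 3) 4 * (n ^ 2 * (n ^ 2 - 1) / 12) +
        m ^ 2 * (m ^ 2 - 1) / 12 * Nat.choose (n + 3) 4 := by
  have hc : ∀ m : ℕ, (Nat.choose (m + 3) 4 : ℂ) = (m ^ 4 + 6 * m ^ 3 + 11 * m ^ 2 + 6 * m) / 24 := by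
    intro m
    have := Nat.descFactorial_eq_factorial_mul_choose (m + 3) 4
    have e : (m + 3).descFactorial 4 = m * (m + 1) * (m + 2) * (m + 3) := by
      simp [Nat.descFactorial]; ring
    rw [e] at this
    have h2 := congrArg (Nat.cast : ℕ → ℂ) this
    simp [Nat.factorial] at h2
    linear_combination - h2 / 24
  have hd : ∀ m : ℕ, 1 ≤ m → ((m ^ 2 * (m ^ 2 - 1) / 12 : ℕ) : ℂ) = (m ^ 4 - m ^ 2) / 12 := by
    intro m hm
    have h12 : 12 ∣ m ^ 2 * (m ^ 2 - 1) := by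
      obtain ⟨k, rfl⟩ := Nat.exists_eq_add_of_le' hm
      have : (k + 1) ^ 2 * ((k + 1) ^ 2 - 1) = (k + 1) ^ 2 * (k ^ 2 + 2 * k) := by
        congr 1
        have : (k + 1) ^ 2 = k ^ 2 + 2 * k + 1 := by ring
        omega
      rw [this, ← CharP.cast_eq_zero_iff (ZMod 12) 12]
      push_cast
      generalize (k : ZMod 12) = z
      revert z
      decide
    rw [Nat.cast_div h12 (by norm_num)]
    have : 1 ≤ m ^ 2 := Nat.one_le_pow _ _ hm
    push_cast [Nat.cast_sub this]
    ring
  have : (N : ℂ) = ((Nat.choose (m + 3) 4 * (n ^ 2 * (n ^ 2 - 1) / 12) +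
        m ^ 2 * (m ^ 2 - 1) / 12 * Nat.choose (n + 3) 4 : ℕ) : ℂ) := by
    rw [Nat.cast_add, Nat.cast_mul, Nat.cast_mul, hc, hc, hd _ hm, hd _ hn, h]
    ring
  exact_mod_cast this

/-- monomial of a quadruple -/
noncomputable def mono4 {ι : Type} (z : Q4 ι) : MvPolynomial ι ℂ :=
  X z.1 * X z.2.1 * (X z.2.2.1 * X z.2.2.2)

lemma pderiv_mono4 {ι : Type} [DecidableEq ι] (g z : Q4 ι) (t : ℂ) :
    pderiv z.1 (pderiv z.2.1 (pderiv z.2.2.1 (pderiv z.2.2.2 (C t * mono4 g)))) =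
      C (∑ k : Fin 3, ∑ j : Fin 8, if g = gD j (sK k z) then t else 0) := by
  obtain ⟨g1, g2, g3, g4⟩ := g
  obtain ⟨z1, z2, z3, z4⟩ := z
  have hX : ∀ i j : ι, pderiv i (X j : MvPolynomial ι ℂ) = C (if j = i then 1 else 0) := by
    intro i j; rw [pderiv_X, Pi.single_apply]; split_ifs <;> simp
  have hI : ∀ (p q r s : Prop) [Decidable p] [Decidable q] [Decidable r] [Decidable s],
      (C (if p ∧ q ∧ r ∧ s then t else 0) : MvPolynomial ι ℂ) =
      C t * (if p then 1 else 0) * (if q then 1 else 0) *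
      (if r then 1 else 0) * (if s then 1 else 0) := by
    intro p q r s _ _ _ _
    by_cases p <;> by_cases q <;> by_cases r <;> by_cases s <;> simp [*]
  simp only [mono4, Derivation.leibniz, pderiv_C, hX, smul_eq_mul, map_add, mul_zero, zero_add,
    add_zero]
  simp only [gD, sK, Fin.sum_univ_succ, Fin.sum_univ_zero]
  simp [-mul_ite, -ite_mul]
  simp only [hI]
  ring

lemma sym_of_sum_zero {ι : Type} [Fintype ι] [DecidableEq ι] (T : Q4 ι → ℂ)
    (h : ∑ z, C (T z) * mono4 z = (0 : MvPolynomial ι ℂ)) (z : Q4 ι) :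
    ∑ k : Fin 3, ∑ j : Fin 8, T (gD j (sK k z)) = 0 := by
  have h2 := congrArg (fun f => pderiv z.1 (pderiv z.2.1 (pderiv z.2.2.1 (pderiv z.2.2.2 f)))) h
  simp only [map_sum, pderiv_mono4, map_zero] at h2
  simp only [← map_sum] at h2
  rw [C_eq_zero, Finset.sum_comm] at h2
  rw [← h2]
  refine Finset.sum_congr rfl fun k _ => ?_
  rw [Finset.sum_comm]
  refine Finset.sum_congr rfl fun j _ => ?_
  simp

lemma sum_zero_of_sym {ι : Type} [Fintype ι] (T : Q4 ι → ℂ)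
    (h : ∀ z, ∑ k : Fin 3, T (sK k z) = 0) :
    ∑ z, C (T z) * mono4 z = (0 : MvPolynomial ι ℂ) := by
  have h3 : ∀ k : Fin 3, ∑ z, C (T (sK k z)) * mono4 z =
      (∑ z, C (T z) * mono4 z : MvPolynomial ι ℂ) := by
    intro k
    have inv : Function.Involutive (sK k : Q4 ι → Q4 ι) := by
      rintro ⟨a, b, c, d⟩; fin_cases k <;> simp [sK]
    refine Fintype.sum_equiv inv.toPerm _ _ ?_
    rintro ⟨a, b, c, d⟩
    fin_cases k <;> simp only [sK, mono4, Function.Involutive.toPerm, Equiv.coe_fn_mk] <;> simp <;> left <;> ring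
  have h4 : ∑ k : Fin 3, ∑ z, C (T (sK k z)) * mono4 z = (0 : MvPolynomial ι ℂ) := by
    rw [Finset.sum_comm]
    refine Finset.sum_eq_zero fun z _ => ?_
    rw [← Finset.sum_mul, ← map_sum, h]; simp
  simp only [h3] at h4
  simpa using h4

lemma quad_zero {ι : Type} [Fintype ι] [DecidableEq ι] (c : ι → ι → ℂ)
    (hc : ∀ i j, c i j = c j i)
    (h : ∑ i, ∑ j, C (c i j) * (X i * X j) = (0 : MvPolynomial ι ℂ)) (i j : ι) : c i j = 0 := by
  have h2 := congrArg (fun f => pderiv i (pderiv j f)) h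
  have hX : ∀ i j : ι, pderiv i (X j : MvPolynomial ι ℂ) = C (if j = i then 1 else 0) := by
    intro i j; rw [pderiv_X, Pi.single_apply]; split_ifs <;> simp
  have key : ∀ a b : ι, pderiv i (pderiv j (C (c a b) * (X a * X b))) =
      (C ((if a = i then (if b = j then c a b else 0) else 0) +
        (if b = i then (if a = j then c a b else 0) else 0)) : MvPolynomial ι ℂ) := by
    intro a b
    simp only [Derivation.leibniz, pderiv_C, hX, smul_eq_mul, map_add, mul_zero, zero_add,
      add_zero]
    simp only [← C_mul, ← C_add]
    congr 1
    split_ifs <;> simp <;> ring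
  simp only [map_sum, key, map_zero] at h2
  simp only [← map_sum] at h2
  rw [C_eq_zero] at h2
  simp [Finset.sum_add_distrib] at h2
  rw [hc j i] at h2
  linear_combination h2 / 2

lemma quad_exists {ι : Type} [Fintype ι] (f : MvPolynomial ι ℂ) (hf : f.IsHomogeneous 2) :
    ∃ c : ι → ι → ℂ, (∀ i j, c i j = c j i) ∧ f = ∑ i, ∑ j, C (c i j) * (X i * X j) := by
  suffices h : ∃ c : ι → ι → ℂ, f = ∑ i, ∑ j, C (c i j) * (X i * X j) by
    obtain ⟨c, hc⟩ := h
    refine ⟨fun i j => (1 / 2) * c i j + (1 / 2) * c j i, fun i j => by ring, ?_⟩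
    have h2 : f = ∑ i, ∑ j, C (c j i) * (X i * X j) := by
      rw [Finset.sum_comm, hc]
      refine Finset.sum_congr rfl fun i _ => Finset.sum_congr rfl fun j _ => ?_
      ring
    have h3 : f = C (1 / 2) * f + C (1 / 2) * f := by
      rw [← add_mul, ← C_add]; norm_num
    rw [h3]
    nth_rewrite 1 [hc]
    nth_rewrite 1 [h2]
    simp only [Finset.mul_sum, ← Finset.sum_add_distrib]
    refine Finset.sum_congr rfl fun i _ => Finset.sum_congr rfl fun j _ => ?_
    simp only [C_add, C_mul]
    ring
  · refine ⟨fun i j => (1 / 2) * coeff 0 (pderiv j (pderiv i f)), ?_⟩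
    have h1 := hf.sum_X_mul_pderiv
    have h2 : ∀ i, (pderiv i f).IsHomogeneous 1 := fun i => hf.pderiv
    have h3 : ∀ i, pderiv i f = ∑ j, C (coeff 0 (pderiv j (pderiv i f))) * X j := by
      intro i
      have := (h2 i).sum_X_mul_pderiv
      rw [one_smul] at this
      conv_lhs => rw [← this]
      refine Finset.sum_congr rfl fun j _ => ?_
      have h0 : (pderiv j (pderiv i f)).IsHomogeneous 0 := (h2 i).pderiv
      rw [mul_comm]
      congr 1
      exact totalDegree_eq_zero_iff_eq_C.1 ((totalDegree_zero_iff_isHomogeneous _).2 h0)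
    have h4 : f = C (1 / 2) * ∑ i, X i * pderiv i f := by
      rw [h1, nsmul_eq_mul, ← mul_assoc]
      have : (C (1 / 2) * ((2 : ℕ) : MvPolynomial ι ℂ)) = 1 := by
        rw [← C_eq_coe_nat, ← C_mul]; norm_num
      rw [this, one_mul]
    conv_lhs => rw [h4]
    rw [Finset.mul_sum]
    refine Finset.sum_congr rfl fun i _ => ?_
    conv_lhs => rw [h3 i]
    rw [Finset.mul_sum, Finset.mul_sum]
    refine Finset.sum_congr rfl fun j _ => ?_
    rw [C_mul]; ring

abbrev UU (m n : ℕ) := (Fin m × Fin m) × (Fin n × Fin n)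

noncomputable instance instFintypePermIdx (m n : ℕ) : Fintype (PermIdx m n) := by
  unfold PermIdx; infer_instance

noncomputable instance instDecEqPermIdx (m n : ℕ) : DecidableEq (PermIdx m n) := Classical.decEq _

/-- sort the indices -/
def srt {m n : ℕ} (u : UU m n) : PermIdx m n :=
  ⟨((min u.1.1 u.1.2, max u.1.1 u.1.2), (min u.2.1 u.2.2, max u.2.1 u.2.2)),
    min_le_max, min_le_max⟩

lemma srt_val {m n : ℕ} (w : PermIdx m n) : srt w.1 = w := by
  obtain ⟨⟨⟨a, b⟩, ⟨c, d⟩⟩, h1, h2⟩ := w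
  apply Subtype.ext
  simp only at h1 h2
  simp [srt, h1, h2]

lemma perm_srt {m n : ℕ} (u : UU m n) : perm (srt u) =
    X (u.1.1, u.2.1) * X (u.1.2, u.2.2) + X (u.1.1, u.2.2) * X (u.1.2, u.2.1) := by
  obtain ⟨⟨a, b⟩, ⟨c, d⟩⟩ := u
  rcases le_total a b with h1 | h1 <;> rcases le_total c d with h2 | h2 <;>
    simp [perm, srt, h1, h2] <;> ring

lemma inv_srt {m n : ℕ} {γ : Type} (g : UU m n → γ)
    (h1 : ∀ a b y, g ((b, a), y) = g ((a, b), y)) (h2 : ∀ x p q, g (x, (q, p)) = g (x, (p, q)))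
    (u : UU m n) : g (srt u).1 = g u := by
  obtain ⟨⟨a, b⟩, ⟨c, d⟩⟩ := u
  rcases le_total a b with k1 | k1 <;> rcases le_total c d with k2 | k2 <;>
    simp [srt, k1, k2, h1 a b, h2 _ c d]

def mix {m n : ℕ} (u v : UU m n) : Q4 (Fin m) × Q4 (Fin n) :=
  ((u.1.1, u.1.2, v.1.1, v.1.2), (u.2.1, u.2.2, v.2.1, v.2.2))

noncomputable def opL (m n : ℕ) :
    (Q4 (Fin m) × Q4 (Fin n) → ℂ) →ₗ[ℂ] MvPolynomial (PermIdx m n) ℂ where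
  toFun T := ∑ u, ∑ v, C (T (mix u v)) * (X (srt u) * X (srt v))
  map_add' T U := by
    simp only [Pi.add_apply, C_add, add_mul, Finset.sum_add_distrib]
  map_smul' z T := by
    simp only [Pi.smul_apply, smul_eq_mul, C_mul, RingHom.id_apply, smul_eq_C_mul, Finset.mul_sum,
      mul_assoc]

noncomputable def cnt {m n : ℕ} (w : PermIdx m n) : ℂ :=
  ∑ u : UU m n, if srt u = w then 1 else 0

lemma cnt_ne {m n : ℕ} (w : PermIdx m n) : cnt w ≠ 0 := by
  unfold cnt
  rw [Finset.sum_boole, Nat.cast_ne_zero, ← Nat.pos_iff_ne_zero, Finset.card_pos]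
  exact ⟨w.1, by simp [srt_val]⟩

lemma sum_srt {m n : ℕ} (g : PermIdx m n → MvPolynomial (PermIdx m n) ℂ) :
    ∑ u, g (srt u) = ∑ w, C (cnt w) * g w := by
  simp only [cnt, map_sum, Finset.sum_mul]
  rw [Finset.sum_comm]
  refine Finset.sum_congr rfl fun u _ => ?_
  rw [Finset.sum_eq_single (srt u)]
  · simp
  · intro b _ hb; simp [hb.symm]
  · simp

lemma opL_of {m n : ℕ} (τ : PermIdx m n → PermIdx m n → ℂ) (T : Q4 (Fin m) × Q4 (Fin n) → ℂ)
    (h : ∀ u v, T (mix u v) = τ (srt u) (srt v)) :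
    opL m n T = ∑ w, ∑ w', C (cnt w * cnt w' * τ w w') * (X w * X w') := by
  change ∑ u, ∑ v, C (T (mix u v)) * (X (srt u) * X (srt v)) = _
  simp only [h]
  rw [sum_srt (fun w => ∑ v, C (τ w (srt v)) * (X w * X (srt v)))]
  refine Finset.sum_congr rfl fun w _ => ?_
  rw [sum_srt (fun w' => C (τ w w') * (X w * X w')), Finset.mul_sum]
  refine Finset.sum_congr rfl fun w' _ => ?_
  rw [C_mul, C_mul]; ring

lemma opL_homog {m n : ℕ} (T : Q4 (Fin m) × Q4 (Fin n) → ℂ) : (opL m n T).IsHomogeneous 2 := by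
  change (∑ u, ∑ v, C (T (mix u v)) * (X (srt u) * X (srt v))).IsHomogeneous 2
  refine IsHomogeneous.sum _ _ _ fun u _ => IsHomogeneous.sum _ _ _ fun v _ => ?_
  have := (isHomogeneous_C (PermIdx m n) (T (mix u v))).mul
    ((isHomogeneous_X ℂ (srt u)).mul (isHomogeneous_X ℂ (srt v)))
  simpa using this

/-- the three symmetries -/
def Inv3 {α β : Type} (T : Q4 α × Q4 β → ℂ) : Prop :=
  (∀ a b c d y, T ((b, a, c, d), y) = T ((a, b, c, d), y)) ∧
    (∀ x p q r s, T (x, (q, p, r, s)) = T (x, (p, q, r, s))) ∧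
    (∀ a b c d p q r s, T ((c, d, a, b), (r, s, p, q)) = T ((a, b, c, d), (p, q, r, s)))

lemma Inv3.srt {m n : ℕ} {T : Q4 (Fin m) × Q4 (Fin n) → ℂ} (h : Inv3 T) (u v : UU m n) :
    T (mix u v) = T (mix (srt u).1 (srt v).1) := by
  obtain ⟨h1, h2, h3⟩ := h
  have hs : ∀ u v : UU m n, T (mix u v) = T (mix v u) := fun u v => (h3 _ _ _ _ _ _ _ _)
  have e1 : ∀ u v : UU m n, T (mix (_root_.srt u).1 v) = T (mix u v) := fun u v =>
    inv_srt (fun u => T (mix u v)) (fun a b y => h1 _ _ _ _ _) (fun x p q => h2 _ _ _ _ _) u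
  rw [e1, hs, ← e1, hs]

lemma opL_inj {m n : ℕ} {T : Q4 (Fin m) × Q4 (Fin n) → ℂ} (h : Inv3 T) (h0 : opL m n T = 0) :
    T = 0 := by
  rw [opL_of (fun w w' => T (mix w.1 w'.1)) T h.srt] at h0
  have h2 := quad_zero (fun w w' => cnt w * cnt w' * T (mix w.1 w'.1)) (fun w w' => by
    have : T (mix w.1 w'.1) = T (mix w'.1 w.1) := h.2.2 _ _ _ _ _ _ _ _
    rw [this]; ring) h0
  funext ⟨⟨a, b, c, d⟩, ⟨p, q, r, s⟩⟩
  have h3 := h2 (_root_.srt ((a, b), (p, q))) (_root_.srt ((c, d), (r, s)))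
  simp only [mul_eq_zero, cnt_ne, false_or] at h3
  rw [← h.srt] at h3
  exact h3

lemma opL_surj {m n : ℕ} (f : MvPolynomial (PermIdx m n) ℂ) (hf : f.IsHomogeneous 2) :
    ∃ T : Q4 (Fin m) × Q4 (Fin n) → ℂ, Inv3 T ∧ opL m n T = f := by
  obtain ⟨c, hc, rfl⟩ := quad_exists f hf
  have swap1 : ∀ (a b : Fin m) (y : Fin n × Fin n), srt ((b, a), y) = srt ((a, b), y) := by
    intro a b y; apply Subtype.ext; simp [srt, min_comm, max_comm]
  have swap2 : ∀ (x : Fin m × Fin m) (p q : Fin n), srt (x, (q, p)) = srt (x, (p, q)) := by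
    intro a b y; apply Subtype.ext; simp [srt, min_comm, max_comm]
  let τ : PermIdx m n → PermIdx m n → ℂ := fun w w' => c w w' / (cnt w * cnt w')
  have hτ : ∀ w w', τ w w' = τ w' w := by
    intro w w'; simp only [τ, hc w w', mul_comm]
  refine ⟨fun x => τ (srt ((x.1.1, x.1.2.1), (x.2.1, x.2.2.1)))
    (srt ((x.1.2.2.1, x.1.2.2.2), (x.2.2.2.1, x.2.2.2.2))), ⟨?_, ?_, ?_⟩, ?_⟩
  · intro a b c d y; simp only [swap1 a b]
  · intro x a b c d; simp only [swap2 _ a b]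
  · intro a b c d p q r s; exact hτ _ _
  · rw [opL_of τ _ (fun u v => rfl)]
    refine Finset.sum_congr rfl fun w _ => Finset.sum_congr rfl fun w' _ => ?_
    congr 2
    have := cnt_ne w
    have := cnt_ne w'
    simp only [τ]
    field_simp

def unz {α β : Type} (z : Q4 (α × β)) : Q4 α × Q4 β :=
  ((z.1.1, z.2.1.1, z.2.2.1.1, z.2.2.2.1), (z.1.2, z.2.1.2, z.2.2.1.2, z.2.2.2.2))

def unzE (m n : ℕ) : UU m n × UU m n ≃ Q4 (Fin m × Fin n) where
  toFun w := ((w.1.1.1, w.1.2.1), (w.1.1.2, w.1.2.2), (w.2.1.1, w.2.2.1), (w.2.1.2, w.2.2.2))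
  invFun z := (((z.1.1, z.2.1.1), (z.1.2, z.2.1.2)), ((z.2.2.1.1, z.2.2.2.1), (z.2.2.1.2, z.2.2.2.2)))
  left_inv _ := rfl
  right_inv _ := rfl

lemma double_sum {m n : ℕ} (g : UU m n → MvPolynomial (Fin m × Fin n) ℂ)
    (hg : ∀ x p q, g (x, (q, p)) = g (x, (p, q))) :
    ∑ u, g u * perm (srt u) = 2 * ∑ u, g u * (X (u.1.1, u.2.1) * X (u.1.2, u.2.2)) := by
  have e : ∑ u : UU m n, g u * (X (u.1.1, u.2.2) * X (u.1.2, u.2.1)) =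
      ∑ u, g u * (X (u.1.1, u.2.1) * X (u.1.2, u.2.2)) := by
    refine Fintype.sum_equiv ((Equiv.refl (Fin m × Fin m)).prodCongr (Equiv.prodComm (Fin n) (Fin n))) _ _ ?_
    rintro ⟨x, p, q⟩
    simp [hg x p q]
  simp only [perm_srt, mul_add, Finset.sum_add_distrib, e]
  ring

lemma PsiBar_opL {m n : ℕ} {T : Q4 (Fin m) × Q4 (Fin n) → ℂ} (h : Inv3 T) :
    PsiBar m n (opL m n T) = 4 * ∑ z, C (T (unz z)) * mono4 z := by
  obtain ⟨h1, h2, h3⟩ := h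
  have h2' : ∀ x p q r s, T (x, (p, q, s, r)) = T (x, (p, q, r, s)) := by
    rintro ⟨a, b, c, d⟩ p q r s; rw [← h3, h2, h3]
  have e1 : PsiBar m n (opL m n T) =
      ∑ u, (∑ v, C (T (mix u v)) * perm (srt v)) * perm (srt u) := by
    change PsiBar m n (∑ u, ∑ v, C (T (mix u v)) * (X (srt u) * X (srt v))) = _
    simp only [PsiBar, map_sum, map_mul, aeval_X, Finset.sum_mul, aeval_C, algebraMap_eq]
    refine Finset.sum_congr rfl fun u _ => Finset.sum_congr rfl fun v _ => ?_
    ring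
  rw [e1, double_sum]
  · have : ∀ u : UU m n, ∑ v, C (T (mix u v)) * perm (srt v) =
        2 * ∑ v, C (T (mix u v)) * (X (v.1.1, v.2.1) * X (v.1.2, v.2.2)) := by
      intro u
      apply double_sum
      intro x p q
      exact congrArg C (h2' _ _ _ _ _)
    simp only [this]
    have e : ∑ z, C (T (unz z)) * mono4 z =
        ∑ u, ∑ v, C (T (unz (unzE m n (u, v)))) * mono4 (unzE m n (u, v)) := by
      rw [← Equiv.sum_comp (unzE m n)]
      exact Fintype.sum_prod_type _
    rw [e]
    simp only [Finset.mul_sum, Finset.sum_mul]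
    refine Finset.sum_congr rfl fun u _ => ?_
    refine Finset.sum_congr rfl fun v _ => ?_
    change _ = 4 * (C (T (mix u v)) * (X (u.1.1, u.2.1) * X (u.1.2, u.2.2) *
      (X (v.1.1, v.2.1) * X (v.1.2, v.2.2))))
    ring
  · intro x p q
    refine Finset.sum_congr rfl fun v _ => ?_
    exact congrArg (fun t => C t * perm (srt v)) (h2 _ _ _ _ _)

lemma PsiBar_zero_iff {m n : ℕ} {T : Q4 (Fin m) × Q4 (Fin n) → ℂ} (h : Inv3 T) :
    PsiBar m n (opL m n T) = 0 ↔ ∀ a b c d p q r s,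
      T ((a, b, c, d), (p, q, r, s)) + T ((a, c, b, d), (p, r, q, s)) +
      T ((a, d, c, b), (p, s, r, q)) = 0 := by
  rw [PsiBar_opL h]
  have h4 : (4 : MvPolynomial (Fin m × Fin n) ℂ) ≠ 0 := by norm_num
  rw [mul_eq_zero, or_iff_right h4]
  constructor
  · intro hs a b c d p q r s
    have k := sym_of_sum_zero (fun z => T (unz z)) hs ((a, p), (b, q), (c, r), (d, s))
    have inv : ∀ j z, T (unz (gD j z)) = T (unz z) := fun j z =>
      opD_of (fun z => T (unz z)) (fun a b c d => (h.1 _ _ _ _ _).trans (h.2.1 _ _ _ _ _))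
        (fun a b c d => h.2.2 _ _ _ _ _ _ _ _) j z
    simp only [inv] at k
    simp [Fin.sum_univ_succ, sK, unz] at k
    linear_combination k / 8
  · intro hq
    refine sum_zero_of_sym (fun z => T (unz z)) ?_
    rintro ⟨⟨a, p⟩, ⟨b, q⟩, ⟨c, r⟩, ⟨d, s⟩⟩
    have := hq a b c d p q r s
    simp [Fin.sum_univ_succ, sK, unz]
    linear_combination this

lemma map_KT (m n : ℕ) : (KT (Fin m) (Fin n)).map (opL m n) = kerPsiBarDeg m n 2 := by
  ext f
  rw [Submodule.mem_map]
  constructor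
  · rintro ⟨T, ⟨h1, h2, h3, h4⟩, rfl⟩
    refine ⟨?_, opL_homog T⟩
    exact (PsiBar_zero_iff ⟨h1, h2, h3⟩).2 h4
  · rintro ⟨hk, hh⟩
    obtain ⟨T, hT, rfl⟩ := opL_surj f hh
    exact ⟨T, ⟨hT.1, hT.2.1, hT.2.2, (PsiBar_zero_iff hT).1 hk⟩, rfl⟩

lemma finrank_ker (m n : ℕ) :
    Module.finrank ℂ (kerPsiBarDeg m n 2) = Module.finrank ℂ (KT (Fin m) (Fin n)) := by
  rw [← map_KT]
  have hinj : Function.Injective ((opL m n).domRestrict (KT (Fin m) (Fin n))) := by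
    rw [injective_iff_map_eq_zero]
    rintro ⟨T, h1, h2, h3, h4⟩ h0
    exact Subtype.ext (opL_inj ⟨h1, h2, h3⟩ h0)
  rw [← LinearMap.finrank_range_of_inj hinj, LinearMap.range_domRestrict (KT (Fin m) (Fin n)) (opL m n)]

/-- The space of quadratic relations among the generalized 2×2 permanents has
dimension `C(m+3,4)·(n²(n²−1)/12) + (m²(m²−1)/12)·C(n+3,4)`. -/
theorem dim_quadratic_relations_permanents (m n : ℕ) (hm : 1 ≤ m) (hn : 1 ≤ n) :
    Module.finrank ℂ (kerPsiBarDeg m n 2) =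
      Nat.choose (m + 3) 4 * (n ^ 2 * (n ^ 2 - 1) / 12) +
        m ^ 2 * (m ^ 2 - 1) / 12 * Nat.choose (n + 3) 4 := by
  rw [finrank_ker]
  exact final_arith m n _ hm hn (finrank_KT m n)
end

section
/- Assume m ≥ n. Then ker Ψ̄ is generated, as an ideal of R̄, by its homogeneous elements of degree at most ⌊n/2⌋ + 2. -/
open MvPolynomial

namespace PermRel

/-- The sorted quadruple given by two unordered pairs. -/
def mkIdx {m n : ℕ} (s : Sym2 (Fin m)) (t : Sym2 (Fin n)) : PermIdx m n :=
  ⟨((s.inf, s.sup), (t.inf, t.sup)), Sym2.inf_le_sup s, Sym2.inf_le_sup t⟩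

/-- The variable attached to an unordered pair of rows and an unordered pair of columns. -/
noncomputable def yv {m n : ℕ} (s : Sym2 (Fin m)) (t : Sym2 (Fin n)) :
    MvPolynomial (PermIdx m n) ℂ :=
  X (mkIdx s t)

noncomputable abbrev Y {m n : ℕ} (i i' : Fin m) (j j' : Fin n) :
    MvPolynomial (PermIdx m n) ℂ := yv s(i, i') s(j, j')

lemma psi_Y {m n : ℕ} (i i' : Fin m) (j j' : Fin n) :
    PsiBar m n (Y i i' j j') = X (i, j) * X (i', j') + X (i, j') * X (i', j) := by
  simp only [PsiBar, Y, yv]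
  rw [aeval_X]
  simp only [perm, mkIdx, Sym2.inf_mk, Sym2.sup_mk]
  rcases le_total i i' with h | h <;> rcases le_total j j' with h' | h' <;>
    simp [h, h'] <;> ring

lemma X_eq_yv {m n : ℕ} (w : PermIdx m n) :
    (X w : MvPolynomial (PermIdx m n) ℂ) = yv s(w.1.1.1, w.1.1.2) s(w.1.2.1, w.1.2.2) := by
  obtain ⟨⟨⟨i, i'⟩, ⟨j, j'⟩⟩, h, h'⟩ := w
  simp only at h h'
  rw [yv]
  congr 1
  apply Subtype.ext
  simp [mkIdx, h, h']

lemma yv_homog {m n : ℕ} (s : Sym2 (Fin m)) (t : Sym2 (Fin n)) :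
    (yv s t).IsHomogeneous 1 := isHomogeneous_X _ _

/-- The ideal generated by the homogeneous relations of degree at most `B`. -/
noncomputable def lowI (m n B : ℕ) : Ideal (MvPolynomial (PermIdx m n) ℂ) :=
  Ideal.span {f | f ∈ RingHom.ker (PsiBar m n) ∧ ∃ d ≤ B, f.IsHomogeneous d}

lemma mul_homog2 {m n : ℕ} (s s' : Sym2 (Fin m)) (t t' : Sym2 (Fin n)) :
    (yv s t * yv s' t').IsHomogeneous 2 := (yv_homog s t).mul (yv_homog s' t')

lemma mul_homog3 {m n : ℕ} (s s' s'' : Sym2 (Fin m)) (t t' t'' : Sym2 (Fin n)) :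
    (yv s t * (yv s' t' * yv s'' t'')).IsHomogeneous 3 :=
  (yv_homog s t).mul (mul_homog2 s' s'' t' t'')

lemma ruleA_mem {m n B : ℕ} (hB : 2 ≤ B) (a b c : Fin m) (u1 u2 v1 v2 : Fin n) :
    (Y a b u1 u2 * Y b c v1 v2 + Y a b v1 v2 * Y b c u1 u2) -
      (C (1/2) * (Y b b u1 v1 * Y a c u2 v2) + C (1/2) * (Y b b u1 v2 * Y a c u2 v1)
       + C (1/2) * (Y b b u2 v1 * Y a c u1 v2) + C (1/2) * (Y b b u2 v2 * Y a c u1 v1))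
      ∈ lowI m n B := by
  apply Ideal.subset_span
  refine ⟨?_, 2, hB, ?_⟩
  · rw [RingHom.mem_ker]
    simp only [map_sub, map_add, map_mul, psi_Y, algHom_C, algebraMap_eq]
    have h2 : (C (1/2 : ℂ) : MvPolynomial (Fin m × Fin n) ℂ) * 2 = 1 := by
      rw [show (2 : MvPolynomial (Fin m × Fin n) ℂ) = C 2 from (map_ofNat C 2).symm, ← C_mul]
      norm_num
    generalize (C (1/2 : ℂ) : MvPolynomial (Fin m × Fin n) ℂ) = q at h2 ⊢
    linear_combination (-(
      X (b, u1) * X (b, v1) * (X (a, u2) * X (c, v2) + X (a, v2) * X (c, u2)) +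
      X (b, u1) * X (b, v2) * (X (a, u2) * X (c, v1) + X (a, v1) * X (c, u2)) +
      X (b, u2) * X (b, v1) * (X (a, u1) * X (c, v2) + X (a, v2) * X (c, u1)) +
      X (b, u2) * X (b, v2) * (X (a, u1) * X (c, v1) + X (a, v1) * X (c, u1)))) * h2
  · rw [← mem_homogeneousSubmodule]
    have g (k : ℂ) s s'  t t'  :=
      (mem_homogeneousSubmodule _ _).2 ((mul_homog2 (m := m) (n := n) s s'  t t' ).C_mul k)
    have g' s s' t t' := (mem_homogeneousSubmodule _ _).2 (mul_homog2 (m := m) (n := n) s s' t t')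
    generalize homogeneousSubmodule (PermIdx m n) ℂ 2 = M at g g' ⊢
    have gadd : ∀ f g, f ∈ M → g ∈ M → f + g ∈ M := fun _ _ => M.add_mem
    refine M.sub_mem ?_ ?_
    all_goals repeat' first
      | with_reducible exact g _ _ _ _ _
      | with_reducible exact g' _ _ _ _
      | with_reducible refine gadd _ _ ?_ ?_

set_option maxHeartbeats 1000000 in
set_option maxRecDepth 4000 in
lemma ruleB_mem {m n B : ℕ} (hB : 3 ≤ B) (a b c d : Fin m) (u1 u2 v1 v2 w1 w2 : Fin n) :
    Y a b u1 u2 * (Y b c v1 v2 * Y c d w1 w2) -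
      (C (4/16) * (Y c c w1 w2 * (Y a b v1 v2 * Y b d u1 u2)) +
      C (4/16) * (Y b b u1 u2 * (Y a c w1 w2 * Y c d v1 v2)) +
      C (2/16) * (Y c c v2 w2 * (Y a b u1 u2 * Y b d v1 w1)) +
      C (2/16) * (Y c c v2 w1 * (Y a b u1 u2 * Y b d v1 w2)) +
      C (2/16) * (Y c c v1 w2 * (Y a b u1 u2 * Y b d v2 w1)) +
      C (2/16) * (Y c c v1 w1 * (Y a b u1 u2 * Y b d v2 w2)) +
      C (2/16) * (Y b b u2 v2 * (Y a c u1 v1 * Y c d w1 w2)) +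
      C (2/16) * (Y b b u2 v1 * (Y a c u1 v2 * Y c d w1 w2)) +
      C (2/16) * (Y b b u1 v2 * (Y a c u2 v1 * Y c d w1 w2)) +
      C (2/16) * (Y b b u1 v1 * (Y a c u2 v2 * Y c d w1 w2)) +
      C (1/16) * (Y b b v1 w1 * (Y c c v2 w2 * Y a d u1 u2)) +
      C (1/16) * (Y b b v1 w2 * (Y c c v2 w1 * Y a d u1 u2)) +
      C (1/16) * (Y b b v2 w1 * (Y c c v1 w2 * Y a d u1 u2)) +
      C (1/16) * (Y b b v2 w2 * (Y c c v1 w1 * Y a d u1 u2)) +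
      C (1/16) * (Y b b u1 v1 * (Y c c u2 v2 * Y a d w1 w2)) +
      C (1/16) * (Y b b u1 v2 * (Y c c u2 v1 * Y a d w1 w2)) +
      C (1/16) * (Y b b u2 v1 * (Y c c u1 v2 * Y a d w1 w2)) +
      C (1/16) * (Y b b u2 v2 * (Y c c u1 v1 * Y a d w1 w2)) +
      C (2/16) * (Y b b u2 v1 * (Y c c v2 w2 * Y a d u1 w1)) +
      C (2/16) * (Y b b u2 v2 * (Y c c v1 w2 * Y a d u1 w1)) +
      C (2/16) * (Y b b u2 v1 * (Y c c v2 w1 * Y a d u1 w2)) +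
      C (2/16) * (Y b b u2 v2 * (Y c c v1 w1 * Y a d u1 w2)) +
      C (2/16) * (Y b b u1 v1 * (Y c c v2 w2 * Y a d u2 w1)) +
      C (2/16) * (Y b b u1 v2 * (Y c c v1 w2 * Y a d u2 w1)) +
      C (2/16) * (Y b b u1 v1 * (Y c c v2 w1 * Y a d u2 w2)) +
      C (2/16) * (Y b b u1 v2 * (Y c c v1 w1 * Y a d u2 w2)) +
      C (-2/16) * (Y c c v2 w2 * (Y a b u1 w1 * Y b d u2 v1)) +
      C (-2/16) * (Y c c v1 w2 * (Y a b u1 w1 * Y b d u2 v2)) +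
      C (-2/16) * (Y c c v2 w1 * (Y a b u1 w2 * Y b d u2 v1)) +
      C (-2/16) * (Y c c v1 w1 * (Y a b u1 w2 * Y b d u2 v2)) +
      C (-2/16) * (Y c c v2 w2 * (Y a b u2 w1 * Y b d u1 v1)) +
      C (-2/16) * (Y c c v1 w2 * (Y a b u2 w1 * Y b d u1 v2)) +
      C (-2/16) * (Y c c v2 w1 * (Y a b u2 w2 * Y b d u1 v1)) +
      C (-2/16) * (Y c c v1 w1 * (Y a b u2 w2 * Y b d u1 v2)) +
      C (-2/16) * (Y b b u1 v2 * (Y a c v1 w1 * Y c d u2 w2)) +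
      C (-2/16) * (Y b b u2 v2 * (Y a c v1 w1 * Y c d u1 w2)) +
      C (-2/16) * (Y b b u1 v2 * (Y a c v1 w2 * Y c d u2 w1)) +
      C (-2/16) * (Y b b u2 v2 * (Y a c v1 w2 * Y c d u1 w1)) +
      C (-2/16) * (Y b b u1 v1 * (Y a c v2 w1 * Y c d u2 w2)) +
      C (-2/16) * (Y b b u2 v1 * (Y a c v2 w1 * Y c d u1 w2)) +
      C (-2/16) * (Y b b u1 v1 * (Y a c v2 w2 * Y c d u2 w1)) +
      C (-2/16) * (Y b b u2 v1 * (Y a c v2 w2 * Y c d u1 w1)))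
      ∈ lowI m n B := by
  apply Ideal.subset_span
  refine ⟨?_, 3, hB, ?_⟩
  · rw [RingHom.mem_ker]
    simp only [map_sub, map_add, map_mul, psi_Y, algHom_C, algebraMap_eq]
    have h2 : ∀ k : ℤ, (C ((k : ℂ)/16) : MvPolynomial (Fin m × Fin n) ℂ) =
        (k : MvPolynomial (Fin m × Fin n) ℂ) * C (1/16) := by
      intro k
      rw [show (k : MvPolynomial (Fin m × Fin n) ℂ) = C (k : ℂ) from (map_intCast (C : ℂ →+* MvPolynomial (Fin m × Fin n) ℂ) k).symm,
        ← C_mul]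
      congr 1
      ring
    have h4 := h2 4
    have h1 := h2 2
    have h0 := h2 (-2)
    push_cast at h4 h1 h0
    rw [h4, h1, h0]
    have h16 : (C (1/16 : ℂ) : MvPolynomial (Fin m × Fin n) ℂ) * 16 = 1 := by
      rw [show (16 : MvPolynomial (Fin m × Fin n) ℂ) = C 16 from (map_ofNat C 16).symm, ← C_mul]
      norm_num
    generalize (C (1/16 : ℂ) : MvPolynomial (Fin m × Fin n) ℂ) = q at h16 ⊢
    linear_combination (-(
      (X (a, u1) * X (b, u2) + X (a, u2) * X (b, u1)) *
      (X (b, v1) * X (c, v2) + X (b, v2) * X (c, v1)) *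
      (X (c, w1) * X (d, w2) + X (c, w2) * X (d, w1)))) * h16
  · rw [← mem_homogeneousSubmodule]
    have g (k : ℂ) s s' s'' t t' t'' :=
      (mem_homogeneousSubmodule _ _).2 ((mul_homog3 (m := m) (n := n) s s' s'' t t' t'').C_mul k)
    have g' s s' s'' t t' t'' :=
      (mem_homogeneousSubmodule _ _).2 (mul_homog3 (m := m) (n := n) s s' s'' t t' t'')
    generalize homogeneousSubmodule (PermIdx m n) ℂ 3 = M at g g' ⊢
    have gadd : ∀ f g, f ∈ M → g ∈ M → f + g ∈ M := fun _ _ => M.add_mem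
    refine M.sub_mem ?_ ?_
    all_goals repeat' first
      | with_reducible exact g _ _ _ _ _ _ _
      | with_reducible exact g' _ _ _ _ _ _
      | with_reducible refine gadd _ _ ?_ ?_

lemma ruleA {m n B : ℕ} (hB : 2 ≤ B) (M : Submodule ℂ (MvPolynomial (PermIdx m n) ℂ))
    (hM : ∀ f ∈ lowI m n B, f ∈ M) (a b c : Fin m) (u v : Sym2 (Fin n))
    (r : MvPolynomial (PermIdx m n) ℂ)
    (h : ∀ s t, yv s(b, b) s * (yv s(a, c) t * r) ∈ M)
    (huv : yv s(a, b) u * yv s(b, c) v = yv s(a, b) v * yv s(b, c) u) :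
    yv s(a, b) u * (yv s(b, c) v * r) ∈ M := by
  induction u using Sym2.ind with | _ u1 u2
  induction v using Sym2.ind with | _ v1 v2
  have key := hM _ (Ideal.mul_mem_right r _ (ruleA_mem hB a b c u1 u2 v1 v2))
  rw [← huv] at key
  have e : yv s(a, b) s(u1, u2) * (yv s(b, c) s(v1, v2) * r) = (1/2 : ℂ) •
     ((Y a b u1 u2 * Y b c v1 v2 + Y a b u1 u2 * Y b c v1 v2 -
      (C (1/2) * (Y b b u1 v1 * Y a c u2 v2) + C (1/2) * (Y b b u1 v2 * Y a c u2 v1)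
       + C (1/2) * (Y b b u2 v1 * Y a c u1 v2) + C (1/2) * (Y b b u2 v2 * Y a c u1 v1))) * r
     + ((1/2 : ℂ) • (Y b b u1 v1 * (Y a c u2 v2 * r)) + (1/2 : ℂ) • (Y b b u1 v2 * (Y a c u2 v1 * r))
       + (1/2 : ℂ) • (Y b b u2 v1 * (Y a c u1 v2 * r)) +
       (1/2 : ℂ) • (Y b b u2 v2 * (Y a c u1 v1 * r)))) := by
    simp only [smul_eq_C_mul]
    have h2 : (C (1/2 : ℂ) : MvPolynomial (PermIdx m n) ℂ) * 2 = 1 := by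
      rw [show (2 : MvPolynomial (PermIdx m n) ℂ) = C 2 from (map_ofNat C 2).symm, ← C_mul]
      norm_num
    linear_combination (-(yv s(a, b) s(u1, u2) * (yv s(b, c) s(v1, v2) * r))) * h2
  rw [e]
  refine M.smul_mem _ (M.add_mem key ?_)
  repeat' first
    | with_reducible exact M.smul_mem _ (h _ _)
    | with_reducible apply M.add_mem

set_option maxHeartbeats 1000000 in
set_option maxRecDepth 4000 in
lemma ruleB {m n B : ℕ} (hB : 3 ≤ B) (M : Submodule ℂ (MvPolynomial (PermIdx m n) ℂ))
    (hM : ∀ f ∈ lowI m n B, f ∈ M) (a b c d : Fin m) (u v w : Sym2 (Fin n))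
    (r : MvPolynomial (PermIdx m n) ℂ)
    (h1 : ∀ s t q, yv s(b, b) s * (yv s(a, c) t * (yv s(c, d) q * r)) ∈ M)
    (h2 : ∀ s t q, yv s(c, c) s * (yv s(a, b) t * (yv s(b, d) q * r)) ∈ M)
    (h3 : ∀ s t q, yv s(b, b) s * (yv s(c, c) t * (yv s(a, d) q * r)) ∈ M) :
    yv s(a, b) u * (yv s(b, c) v * (yv s(c, d) w * r)) ∈ M := by
  induction u using Sym2.ind with | _ u1 u2
  induction v using Sym2.ind with | _ v1 v2
  induction w using Sym2.ind with | _ w1 w2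
  have key := hM _ (Ideal.mul_mem_right r _ (ruleB_mem hB a b c d u1 u2 v1 v2 w1 w2))
  rw [sub_mul] at key
  have e : yv s(a, b) s(u1, u2) * (yv s(b, c) s(v1, v2) * (yv s(c, d) s(w1, w2) * r)) =
    Y a b u1 u2 * (Y b c v1 v2 * Y c d w1 w2) * r := by ring
  rw [e]
  refine (M.sub_mem_iff_left ?_).1 key
  have g1 : ∀ (k : ℂ) s t q, C k * (yv s(b, b) s * (yv s(a, c) t * yv s(c, d) q)) * r ∈ M := by
    intro k s t q
    rw [mul_assoc, ← smul_eq_C_mul]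
    simpa only [mul_assoc] using M.smul_mem k (h1 s t q)
  have g2 : ∀ (k : ℂ) s t q, C k * (yv s(c, c) s * (yv s(a, b) t * yv s(b, d) q)) * r ∈ M := by
    intro k s t q
    rw [mul_assoc, ← smul_eq_C_mul]
    simpa only [mul_assoc] using M.smul_mem k (h2 s t q)
  have g3 : ∀ (k : ℂ) s t q, C k * (yv s(b, b) s * (yv s(c, c) t * yv s(a, d) q)) * r ∈ M := by
    intro k s t q
    rw [mul_assoc, ← smul_eq_C_mul]
    simpa only [mul_assoc] using M.smul_mem k (h3 s t q)
  simp only [add_mul]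
  repeat' first
    | with_reducible exact g1 _ _ _ _
    | with_reducible exact g2 _ _ _ _
    | with_reducible exact g3 _ _ _ _
    | with_reducible apply M.add_mem

/-- Labelled edges. -/
abbrev Edge (m n : ℕ) := (Fin m × Fin m) × Sym2 (Fin n)

noncomputable def ye {m n : ℕ} (k : Edge m n) : MvPolynomial (PermIdx m n) ℂ :=
  yv s(k.1.1, k.1.2) k.2

def wt {m n : ℕ} (k : Edge m n) (v : Fin m) : ℕ :=
  (if k.1.1 = v then 1 else 0) + (if k.1.2 = v then 1 else 0)

def deg {m n : ℕ} (l : Multiset (Edge m n)) (v : Fin m) : ℕ := (l.map (fun k => wt k v)).sum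

noncomputable def pr {m n : ℕ} (l : Multiset (Edge m n)) : MvPolynomial (PermIdx m n) ℂ :=
  (l.map ye).prod

lemma deg_cons {m n : ℕ} (k : Edge m n) (l : Multiset (Edge m n)) (v : Fin m) :
    deg (k ::ₘ l) v = wt k v + deg l v := by simp [deg]

lemma pr_cons {m n : ℕ} (k : Edge m n) (l : Multiset (Edge m n)) :
    pr (k ::ₘ l) = yv s(k.1.1, k.1.2) k.2 * pr l := by simp [pr, ye]

lemma peel {m n : ℕ} (l : Multiset (Edge m n)) (b : Fin m) (h : deg l b ≠ 0) :
    ∃ (a : Fin m) (u : Sym2 (Fin n)) (l' : Multiset (Edge m n)),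
      pr l = yv s(a, b) u * pr l' ∧
      ∀ v, deg l v = (if a = v then 1 else 0) + (if b = v then 1 else 0) + deg l' v := by
  have : ∃ k ∈ l, wt k b ≠ 0 := by
    by_contra! hc
    apply h
    rw [deg, Multiset.sum_eq_zero]
    intro x hx
    obtain ⟨k, hk, rfl⟩ := Multiset.mem_map.1 hx
    exact hc k hk
  obtain ⟨⟨⟨i, i'⟩, u⟩, hk, hw⟩ := this
  obtain ⟨l', rfl⟩ := Multiset.exists_cons_of_mem hk
  by_cases hb : i' = b
  · subst hb
    exact ⟨i, u, l', pr_cons _ _, fun v => deg_cons _ _ v⟩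
  · have : i = b := by
      by_contra hi
      simp [wt, hb, hi] at hw
    subst this
    refine ⟨i', u, l', ?_, fun v => ?_⟩
    · rw [pr_cons, Sym2.eq_swap]
    · rw [deg_cons]
      simp only [wt]
      ring

/-- relations of low degree plus loop monomials on the vertex set `A`. -/
noncomputable def MA (m n B : ℕ) (A : Finset (Fin m)) :
    Submodule ℂ (MvPolynomial (PermIdx m n) ℂ) :=
  (lowI m n B).restrictScalars ℂ ⊔
    Submodule.span ℂ (Set.range fun J : Fin m → Sym2 (Fin n) => ∏ a ∈ A, yv s(a, a) (J a))

lemma MA_step {m n B : ℕ} (A : Finset (Fin m)) (b : Fin m) (hb : b ∈ A) (t : Sym2 (Fin n))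
    (f : MvPolynomial (PermIdx m n) ℂ) (hf : f ∈ MA m n B (A.erase b)) :
    yv s(b, b) t * f ∈ MA m n B A := by
  obtain ⟨f1, h1, f2, h2, rfl⟩ := Submodule.mem_sup.1 hf
  rw [mul_add]
  refine Submodule.add_mem _ (Submodule.mem_sup_left ?_) (Submodule.mem_sup_right ?_)
  · exact Ideal.mul_mem_left _ _ h1
  · clear hf
    induction h2 using Submodule.span_induction with
    | mem x hx =>
      obtain ⟨J, rfl⟩ := hx
      apply Submodule.subset_span
      refine ⟨Function.update J b t, ?_⟩
      simp only
      rw [← Finset.mul_prod_erase A _ hb, Function.update_self]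
      congr 1
      refine Finset.prod_congr rfl fun x hx => ?_
      rw [Function.update_of_ne (Finset.ne_of_mem_erase hx)]
    | zero => simp
    | add x y _ _ hx hy => rw [mul_add]; exact Submodule.add_mem _ hx hy
    | smul c x _ hx => rw [mul_smul_comm]; exact Submodule.smul_mem _ _ hx

lemma loopify {m n B : ℕ} (hn : 1 ≤ n) (hB : 2 ≤ B) (hB' : 3 ≤ B ∨ n = 1) : ∀ (N : ℕ) (A : Finset (Fin m)),
    A.card = N → ∀ l : Multiset (Edge m n), (∀ v, deg l v = if v ∈ A then 2 else 0) →
    pr l ∈ MA m n B A := by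
  intro N
  induction N with
  | zero =>
    intro A hA l hl
    obtain rfl := Finset.card_eq_zero.1 hA
    have : l = 0 := by
      by_contra hne
      obtain ⟨k, hk⟩ := Multiset.exists_mem_of_ne_zero hne
      obtain ⟨l', rfl⟩ := Multiset.exists_cons_of_mem hk
      have := hl k.1.1
      rw [deg_cons] at this
      simp [wt] at this
    subst this
    refine Submodule.mem_sup_right ?_
    exact Submodule.subset_span ⟨fun _ => s(⟨0, hn⟩, ⟨0, hn⟩), by simp [pr]⟩
  | succ N ih =>
    intro A hA l hl
    have hM : ∀ f ∈ lowI m n B, f ∈ MA m n B A := fun f hf => Submodule.mem_sup_left hf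
    have step : ∀ (b : Fin m) (t : Sym2 (Fin n)) (l' : Multiset (Edge m n)),
        (∀ v, (if v ∈ A then 2 else 0) = (if b = v then 2 else 0) + deg l' v) →
        yv s(b, b) t * pr l' ∈ MA m n B A := by
      intro b t l' h
      have hb : b ∈ A := by
        by_contra hb
        have := h b
        simp [hb] at this
        omega
      refine MA_step A b hb t _ (ih (A.erase b) (by rw [Finset.card_erase_of_mem hb]; omega) l' ?_)
      intro v
      have := h v
      simp only [Finset.mem_erase]
      by_cases hv : b = v
      · subst hv
        simp [hb] at this ⊢
        exact this
      · simp [hv] at this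
        simp [Ne.symm hv, this]
    obtain ⟨b, hb⟩ : A.Nonempty := by rw [← Finset.card_pos]; omega
    obtain ⟨a, u, l1, e1, d1⟩ := peel l b (by rw [hl b]; simp [hb])
    rw [e1]
    by_cases hab : a = b
    · subst hab
      refine step a u l1 fun v => ?_
      rw [← hl v, d1 v]
      split_ifs <;> omega
    have hdb : deg l1 b = 1 := by
      have := d1 b
      rw [hl b] at this
      simp [hb, hab] at this
      omega
    obtain ⟨c, v, l2, e2, d2⟩ := peel l1 b (by omega)
    rw [e2, show s(c, b) = s(b, c) from Sym2.eq_swap]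
    have hcb : c ≠ b := by
      rintro rfl
      have := d2 c
      simp at this
      omega
    by_cases hA2 : n = 1 ∨ c = a
    · refine ruleA hB _ hM a b c u v _ (fun s t => ?_) ?_
      · have := step b s (((a, c), t) ::ₘ l2) fun x => ?_
        · rwa [pr_cons] at this
        rw [← hl x, d1, d2, deg_cons]
        simp only [wt]
        split_ifs <;> omega
      · rcases hA2 with rfl | rfl
        · have : u = v := by
            induction u using Sym2.ind
            induction v using Sym2.ind
            congr 1 <;>
              exact Subsingleton.elim _ _
          rw [this]
        · rw [show s(b, c) = s(c, b) from Sym2.eq_swap, mul_comm]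
    push Not at hA2
    obtain ⟨hn1, hca⟩ := hA2
    have hdc : deg l2 c = 1 := by
      have h1 := d1 c
      have h2 := d2 c
      have hc := hl c
      simp [hcb.symm, hca.symm] at h1 h2
      split_ifs at hc <;> omega
    obtain ⟨d, w, l3, e3, d3⟩ := peel l2 c (by omega)
    rw [e3, show s(d, c) = s(c, d) from Sym2.eq_swap]
    refine ruleB (hB'.resolve_right hn1) _ hM a b c d u v w _ ?_ ?_ ?_
    · intro s t q
      have := step b s (((a, c), t) ::ₘ ((c, d), q) ::ₘ l3) fun x => ?_
      · rwa [pr_cons, pr_cons] at this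
      rw [← hl x, d1, d2, d3, deg_cons, deg_cons]
      simp only [wt]
      split_ifs <;> omega
    · intro s t q
      have := step c s (((a, b), t) ::ₘ ((b, d), q) ::ₘ l3) fun x => ?_
      · rwa [pr_cons, pr_cons] at this
      rw [← hl x, d1, d2, d3, deg_cons, deg_cons]
      simp only [wt]
      split_ifs <;> omega
    · intro s t q
      have := step b s (((c, c), t) ::ₘ ((a, d), q) ::ₘ l3) fun x => ?_
      · rwa [pr_cons, pr_cons] at this
      rw [← hl x, d1, d2, d3, deg_cons, deg_cons]
      simp only [wt]
      split_ifs <;> omega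

/-! ### Loop monomials are linearly independent modulo the kernel -/

lemma lowI_le_ker (m n B : ℕ) : lowI m n B ≤ RingHom.ker (PsiBar m n) :=
  Ideal.span_le.2 fun _ hf => hf.1

/-- The exponent vector of an unordered pair of columns placed in row `a`. -/
noncomputable def ex {d n : ℕ} (a : Fin d) (t : Sym2 (Fin n)) : (Fin d × Fin n) →₀ ℕ :=
  Finsupp.single (a, t.inf) 1 + Finsupp.single (a, t.sup) 1

lemma psi_loop {d n : ℕ} (a : Fin d) (t : Sym2 (Fin n)) :
    PsiBar d n (yv s(a, a) t) = C 2 * monomial (ex a t) 1 := by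
  have h : PsiBar d n (yv s(a, a) t) = X (a, t.inf) * X (a, t.sup) + X (a, t.sup) * X (a, t.inf) := by
    simp only [PsiBar, yv]
    rw [aeval_X]
    simp [perm, mkIdx]
  rw [h, ex, show (2 : ℂ) = 1 + 1 by norm_num, C_add, C_1]
  have : (monomial (Finsupp.single (a, t.inf) 1 + Finsupp.single (a, t.sup) 1) (1 : ℂ))
     = X (a, t.inf) * X (a, t.sup) := by
    simp [X, monomial_mul]
  rw [this]; ring

lemma pair_aux {n : ℕ} (x y z w : Fin n)
    (h : ∀ j, ((if x = j then 1 else 0) + (if y = j then 1 else 0) : ℕ)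
      = (if z = j then 1 else 0) + (if w = j then 1 else 0)) : s(x, y) = s(z, w) := by
  have e1 := h x
  have e2 := h y
  have e3 := h z
  clear h
  rw [Sym2.eq_iff]
  grind

lemma ex_inj {d n : ℕ} (J J' : Fin d → Sym2 (Fin n))
    (h : ∑ a, ex a (J a) = ∑ a, ex a (J' a)) : J = J' := by
  have key : ∀ (J : Fin d → Sym2 (Fin n)) (a : Fin d) (j : Fin n), (∑ a, ex a (J a)) (a, j) =
      (if (J a).inf = j then 1 else 0) + (if (J a).sup = j then 1 else 0) := by
    intro J a j
    rw [Finsupp.finsetSum_apply, Finset.sum_eq_single a]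
    · simp [ex, Finsupp.single_apply]
    · intro b _ hb
      simp [ex, hb]
    · simp
  funext a
  have h1 : ∀ j, ((if (J a).inf = j then 1 else 0) + (if (J a).sup = j then 1 else 0) : ℕ)
      = (if (J' a).inf = j then 1 else 0) + (if (J' a).sup = j then 1 else 0) := by
    intro j; rw [← key, ← key, h]
  have : s((J a).inf, (J a).sup) = s((J' a).inf, (J' a).sup) := pair_aux _ _ _ _ h1
  have s2 : ∀ t : Sym2 (Fin n), s(t.inf, t.sup) = t := by
    intro t
    induction t with
    | _ x y => rcases le_total x y with h | h <;> simp [h]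
  rwa [s2, s2] at this

lemma loop_inj {d n B : ℕ} (f : MvPolynomial (PermIdx d n) ℂ)
    (hf : f ∈ MA d n B Finset.univ) (h0 : PsiBar d n f = 0) : f ∈ lowI d n B := by
  obtain ⟨f1, h1, f2, h2, rfl⟩ := Submodule.mem_sup.1 hf
  have h1' : PsiBar d n f1 = 0 := lowI_le_ker d n B h1
  rw [map_add, h1', zero_add] at h0
  obtain ⟨c, rfl⟩ := (Submodule.mem_span_range_iff_exists_fun ℂ).1 h2
  have hc : ∀ J, c J = 0 := by
    intro J
    have h3 : ∀ J : Fin d → Sym2 (Fin n), PsiBar d n (∏ a, yv s(a, a) (J a)) =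
        monomial (∑ a, ex a (J a)) ((2 : ℂ) ^ d) := by
      intro J
      simp only [map_prod, psi_loop, Finset.prod_mul_distrib, ← monomial_sum_one]
      rw [Finset.prod_const, ← C_pow, C_mul_monomial]
      simp
    simp only [map_sum, map_smul, h3] at h0
    have h4 := congrArg (coeff (∑ a, ex a (J a))) h0
    rw [coeff_sum, Finset.sum_eq_single J] at h4
    · simpa using h4
    · intro J' _ hJ
      have : (∑ a, ex a (J' a)) ≠ ∑ a, ex a (J a) := fun h => hJ (ex_inj _ _ h)
      simp [coeff_monomial, this]
    · simp
  simpa [hc] using h1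

/-! ### Substitutions -/

lemma phi_aux {p r n : ℕ} (G : Fin p → Fin r → ℂ) (i i' : Fin r) (t : Sym2 (Fin n)) :
    ∑ b, ∑ b', (C (G b i * G b' i') * yv s(b, b') t : MvPolynomial (PermIdx p n) ℂ) =
    ∑ b, ∑ b', (C (G b i' * G b' i) * yv s(b, b') t : MvPolynomial (PermIdx p n) ℂ) := by
  rw [Finset.sum_comm]
  refine Finset.sum_congr rfl fun b _ => Finset.sum_congr rfl fun b' _ => ?_
  rw [Sym2.eq_swap, mul_comm (G b' i)]

/-- Row substitution on the source ring. -/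
noncomputable def phi {p r : ℕ} (n : ℕ) (G : Fin p → Fin r → ℂ) :
    MvPolynomial (PermIdx r n) ℂ →ₐ[ℂ] MvPolynomial (PermIdx p n) ℂ :=
  aeval fun w => ∑ b, ∑ b', C (G b w.1.1.1 * G b' w.1.1.2) * yv s(b, b') s(w.1.2.1, w.1.2.2)

/-- Row substitution on the target ring. -/
noncomputable def theta {p r : ℕ} (n : ℕ) (G : Fin p → Fin r → ℂ) :
    MvPolynomial (Fin r × Fin n) ℂ →ₐ[ℂ] MvPolynomial (Fin p × Fin n) ℂ :=
  aeval fun x => ∑ b, C (G b x.1) * X (b, x.2)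

lemma phi_yv {p r n : ℕ} (G : Fin p → Fin r → ℂ) (i i' : Fin r) (t : Sym2 (Fin n)) :
    phi n G (yv s(i, i') t) = ∑ b, ∑ b', C (G b i * G b' i') * yv s(b, b') t := by
  induction t with
  | _ j j' =>
  have e : (s((s(j, j') : Sym2 (Fin n)).inf, (s(j, j') : Sym2 (Fin n)).sup)) = s(j, j') := by
    rcases le_total j j' with h | h <;> simp [h]
  rw [phi, yv, aeval_X]
  simp only [mkIdx]
  rw [e]
  rcases le_total i i' with h | h
  · simp [h]
  · simp only [Sym2.inf_mk, Sym2.sup_mk, h, inf_of_le_right, sup_of_le_left]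
    exact phi_aux G i' i _

lemma psi_phi {p r n : ℕ} (G : Fin p → Fin r → ℂ) (f : MvPolynomial (PermIdx r n) ℂ) :
    PsiBar p n (phi n G f) = theta n G (PsiBar r n f) := by
  have : (PsiBar p n).comp (phi n G) = (theta n G).comp (PsiBar r n) := by
    apply algHom_ext
    intro w
    rw [X_eq_yv, AlgHom.comp_apply, AlgHom.comp_apply, phi_yv, psi_Y]
    simp only [map_sum, map_mul, map_add, psi_Y, algHom_C, algebraMap_eq, theta, aeval_X,
      Finset.sum_mul_sum, ← Finset.sum_add_distrib]
    refine Finset.sum_congr rfl fun b _ => Finset.sum_congr rfl fun b' _ => ?_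
    ring
  exact DFunLike.congr_fun this f

lemma phi_low {p r n B : ℕ} (G : Fin p → Fin r → ℂ) (f : MvPolynomial (PermIdx r n) ℂ)
    (hf : f ∈ lowI r n B) : phi n G f ∈ lowI p n B := by
  have : lowI r n B ≤ (lowI p n B).comap (phi n G) := by
    refine Ideal.span_le.2 ?_
    rintro g ⟨hg, d, hd, hgd⟩
    refine Ideal.subset_span ⟨?_, d, hd, ?_⟩
    · rw [RingHom.mem_ker] at hg ⊢
      rw [psi_phi, hg, map_zero]
    · have := hgd.aeval (S := ℂ) (n := 1)
        (fun w => ∑ b, ∑ b', C (G b w.1.1.1 * G b' w.1.1.2) * yv s(b, b') s(w.1.2.1, w.1.2.2))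
        (fun w => IsHomogeneous.sum _ _ _ fun b _ => IsHomogeneous.sum _ _ _ fun b' _ =>
          (yv_homog _ _).C_mul _)
      rw [one_mul] at this
      exact this
  exact this hf

/-! ### Tensors -/

/-- Index set of tensors: ordered lists of edges. -/
abbrev TK (d m n : ℕ) := Fin d → Edge m n

/-- The polynomial attached to a tensor. -/
noncomputable def qm (d m n : ℕ) : (TK d m n → ℂ) →ₗ[ℂ] MvPolynomial (PermIdx m n) ℂ :=
  Fintype.linearCombination ℂ (fun k : TK d m n => ∏ a, ye (k a))

lemma qm_apply {d m n : ℕ} (t : TK d m n → ℂ) : qm d m n t = ∑ k, t k • ∏ a, ye (k a) := by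
  rw [qm, Fintype.linearCombination_apply]

lemma qm_single {d m n : ℕ} (k : TK d m n) (c : ℂ) :
    qm d m n (Pi.single k c) = c • ∏ a, ye (k a) := by
  rw [qm, Fintype.linearCombination_apply_single]

/-- The matrix entry of a row substitution on edges. -/
def ent {p r n : ℕ} (G : Fin p → Fin r → ℂ) (e : Edge p n) (e' : Edge r n) : ℂ :=
  if e.2 = e'.2 then G e.1.1 e'.1.1 * G e.1.2 e'.1.2 else 0

/-- The matrix of a row substitution on tensors. -/
def TG (d n : ℕ) {p r : ℕ} (G : Fin p → Fin r → ℂ) : Matrix (TK d p n) (TK d r n) ℂ :=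
  fun k l => ∏ a, ent G (k a) (l a)

lemma phi_ye {p r n : ℕ} (G : Fin p → Fin r → ℂ) (e : Edge r n) :
    phi n G (ye e) = ∑ e' : Edge p n, ent G e' e • ye e' := by
  rw [ye, phi_yv, Fintype.sum_prod_type, Fintype.sum_prod_type]
  refine Finset.sum_congr rfl fun b _ => Finset.sum_congr rfl fun b' _ => ?_
  rw [Finset.sum_eq_single e.2]
  · simp [ent, ye, C_mul', smul_smul]
  · intro t _ ht
    simp [ent, ht]
  · simp

lemma q_TG {d p r n : ℕ} (G : Fin p → Fin r → ℂ) (t : TK d r n → ℂ) :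
    qm d p n ((TG d n G).mulVec t) = phi n G (qm d r n t) := by
  have h : ∀ l : TK d r n, phi n G (∏ a, ye (l a)) = ∑ k, TG d n G k l • ∏ a, ye (k a) := by
    intro l
    simp only [map_prod, phi_ye]
    rw [Finset.prod_univ_sum, Fintype.piFinset_univ]
    refine Finset.sum_congr rfl fun k _ => ?_
    rw [TG, Finset.prod_smul]
  simp only [qm_apply, map_sum, map_smul, h, Matrix.mulVec, dotProduct, Finset.sum_smul,
    Finset.smul_sum]
  rw [Finset.sum_comm]
  refine Finset.sum_congr rfl fun l _ => Finset.sum_congr rfl fun k _ => ?_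
  rw [smul_smul, mul_comm]

lemma TG_adj {d p r n : ℕ} (G : Fin p → Fin r → ℂ) (hG : ∀ b a, star (G b a) = G b a)
    (x : TK d r n → ℂ) (f : TK d p n → ℂ) :
    star x ⬝ᵥ ((TG d n fun a b => G b a).mulVec f) = star ((TG d n G).mulVec x) ⬝ᵥ f := by
  have h : (TG d n fun a b => G b a) = (TG d n G).conjTranspose := by
    ext k l
    rw [Matrix.conjTranspose_apply, TG, TG, star_prod]
    refine Finset.prod_congr rfl fun a _ => ?_
    simp only [ent, eq_comm (a := (k a).2)]
    split_ifs <;> simp [star_mul', hG]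
  rw [h, Matrix.star_mulVec, Matrix.dotProduct_mulVec]

lemma orth {K : Type*} [Fintype K] (N : Submodule ℂ (K → ℂ)) (f : K → ℂ) :
    ∃ n0 ∈ N, ∀ x ∈ N, star x ⬝ᵥ (f - n0) = 0 := by
  let e := WithLp.linearEquiv 2 ℂ (K → ℂ)
  let N' : Submodule ℂ (EuclideanSpace ℂ K) := N.comap e.toLinearMap
  refine ⟨WithLp.ofLp (N'.starProjection (WithLp.toLp 2 f)), ?_, ?_⟩
  · exact N'.starProjection_apply_mem (WithLp.toLp 2 f)
  · intro x hx
    have h := N'.sub_starProjection_mem_orthogonal (WithLp.toLp 2 f)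
    have h2 := (Submodule.mem_orthogonal _ _).1 h (WithLp.toLp 2 x) hx
    rw [EuclideanSpace.inner_eq_star_dotProduct] at h2
    rw [dotProduct_comm]
    exact h2

/-- Tensors representing elements of the low degree ideal. -/
noncomputable def lowT (d m n B : ℕ) : Submodule ℂ (TK d m n → ℂ) :=
  ((lowI m n B).restrictScalars ℂ).comap (qm d m n)

lemma mem_lowT {d m n B : ℕ} (t : TK d m n → ℂ) : t ∈ lowT d m n B ↔ qm d m n t ∈ lowI m n B :=
  Iff.rfl

lemma psi_ye_wh {m n : ℕ} (e : Edge m n) :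
    IsWeightedHomogeneous (fun x : Fin m × Fin n => (Pi.single x.1 1 : Fin m → ℕ))
      (PsiBar m n (ye e)) (wt e) := by
  obtain ⟨⟨i, i'⟩, t⟩ := e
  induction t with
  | _ j j' =>
  rw [ye, psi_Y]
  have h : wt (((i, i'), s(j, j')) : Edge m n) = Pi.single i 1 + Pi.single i' 1 := by
    funext v
    simp [wt, Pi.single_apply, eq_comm]
  rw [h]
  exact ((isWeightedHomogeneous_X ℂ _ _).mul (isWeightedHomogeneous_X ℂ _ _)).add
    ((isWeightedHomogeneous_X ℂ _ _).mul (isWeightedHomogeneous_X ℂ _ _))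

lemma weight_zero {d n B : ℕ} (hn : 1 ≤ n) (hB : 2 ≤ B) (hB' : 3 ≤ B ∨ n = 1)
    (h : TK d d n → ℂ) (h0 : PsiBar d n (qm d d n h) = 0)
    (hN : ∀ x ∈ lowT d d n B, star x ⬝ᵥ h = 0) (l : TK d d n)
    (hl : ∀ v, ∑ a, wt (l a) v = 2) : h l = 0 := by
  classical
  let h' : TK d d n → ℂ := fun l => if ∀ v, ∑ a, wt (l a) v = 2 then h l else 0
  have hq : qm d d n h' ∈ lowI d n B := by
    apply loop_inj
    · rw [qm_apply]
      refine Submodule.sum_mem _ fun k _ => ?_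
      by_cases hk : ∀ v, ∑ a, wt (k a) v = 2
      · refine Submodule.smul_mem _ _ ?_
        have := loopify hn hB hB' _ Finset.univ rfl (Finset.univ.val.map k) (by
          intro v
          simp only [deg, Multiset.map_map, Finset.mem_univ, if_true]
          exact hk v)
        rw [pr, Multiset.map_map] at this
        exact this
      · simp [h', hk]
    · have h1 := congrArg (weightedHomogeneousComponent
        (fun x : Fin d × Fin n => (Pi.single x.1 1 : Fin d → ℕ)) (fun _ => 2)) h0
      rw [map_zero] at h1
      rw [← h1]
      simp only [qm_apply, map_sum, map_smul]
      refine Finset.sum_congr rfl fun k _ => ?_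
      have hk : IsWeightedHomogeneous (fun x : Fin d × Fin n => (Pi.single x.1 1 : Fin d → ℕ))
          (PsiBar d n (∏ a, ye (k a))) (∑ a, wt (k a)) := by
        rw [map_prod]
        exact IsWeightedHomogeneous.prod _ _ _ fun a _ => psi_ye_wh _
      rw [weightedHomogeneousComponent_of_mem hk]
      have e : (∀ v, ∑ a, wt (k a) v = 2) ↔ (fun _ => 2) = ∑ a, wt (k a) := by
        rw [_root_.funext_iff]
        simp [Finset.sum_apply, eq_comm]
      by_cases hk : ∀ v, ∑ a, wt (k a) v = 2
      · rw [if_pos (e.1 hk)]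
        simp only [h', if_pos hk]
      · rw [if_neg (fun hh => hk (e.2 hh))]
        simp only [h', if_neg hk, zero_smul, smul_zero]
  have h2 := hN h' hq
  have h3 : star h' ⬝ᵥ h' = 0 := by
    rw [← h2]
    refine Finset.sum_congr rfl fun k _ => ?_
    by_cases hk : ∀ v, ∑ a, wt (k a) v = 2
    · simp only [h', if_pos hk]
    · simp only [h', Pi.star_apply, if_neg hk, star_zero, zero_mul]
  have h4 : h' = 0 := by
    open ComplexOrder in exact dotProduct_star_self_eq_zero.1 h3
  have h5 : h' l = 0 := by rw [h4]; rfl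
  simpa only [h', if_pos hl] using h5

/-! ### Polarization and the main argument -/

/-- The sign attached to a boolean. -/
def sg (β : Bool) : ℂ := if β then 1 else -1

/-- The polarization vector of an edge. -/
def gv {m n : ℕ} (e : Edge m n) (β : Bool) (b : Fin m) : ℂ :=
  (if b = e.1.1 then 1 else 0) + sg β * (if b = e.1.2 then 1 else 0)

lemma gv_star {m n : ℕ} (e : Edge m n) (β : Bool) (b : Fin m) : star (gv e β b) = gv e β b := by
  cases β <;> simp only [gv, sg] <;> split_ifs <;> simp

lemma gv_sum {m n : ℕ} (e : Edge m n) (β : Bool) :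
    ∑ b, ∑ b', C (gv e β b * gv e β b') * (yv s(b, b') e.2 : MvPolynomial (PermIdx m n) ℂ) =
      yv s(e.1.1, e.1.1) e.2 + C (sg β) * (2 * ye e) + C (sg β ^ 2) * yv s(e.1.2, e.1.2) e.2 := by
  have h : ∀ F : Fin m → MvPolynomial (PermIdx m n) ℂ,
      ∑ b, C (gv e β b) * F b = F e.1.1 + C (sg β) * F e.1.2 := by
    intro F
    simp only [gv, C_add, add_mul, Finset.sum_add_distrib, apply_ite (C : ℂ → _), C_1, C_0,
      mul_ite, ite_mul, one_mul, zero_mul, mul_one, mul_zero, Finset.sum_ite_eq', Finset.mem_univ,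
      if_true]
  simp only [C_mul, mul_assoc, ← Finset.mul_sum, h]
  rw [ye, Sym2.eq_swap (a := e.1.2) (b := e.1.1), C_pow]
  ring

lemma polar {m n : ℕ} (e : Edge m n) :
    ye e = ∑ β : Bool, (sg β / 4) •
      ∑ b, ∑ b', C (gv e β b * gv e β b') * (yv s(b, b') e.2 : MvPolynomial (PermIdx m n) ℂ) := by
  simp only [gv_sum, Fintype.sum_bool, sg, if_true, Bool.false_eq_true, if_false, smul_eq_C_mul]
  have h : (C (1 / 4 : ℂ) : MvPolynomial (PermIdx m n) ℂ) * 4 = 1 := by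
    rw [show (4 : MvPolynomial (PermIdx m n) ℂ) = C 4 from (map_ofNat C 4).symm, ← C_mul]
    norm_num
  rw [show (-1 / 4 : ℂ) = -(1 / 4) by norm_num]
  simp only [C_neg, C_1, C_pow]
  linear_combination (-ye e) * h

lemma main_lemma {d m n B : ℕ} (hn : 1 ≤ n) (hB : 2 ≤ B) (hB' : 3 ≤ B ∨ n = 1)
    (f : TK d m n → ℂ) (hf : PsiBar m n (qm d m n f) = 0) : qm d m n f ∈ lowI m n B := by
  classical
  obtain ⟨n0, hn0, horth⟩ := orth (lowT d m n B) f
  have hk0 : PsiBar m n (qm d m n n0) = 0 := lowI_le_ker m n B hn0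
  set g := f - n0 with hg
  have hg0 : PsiBar m n (qm d m n g) = 0 := by rw [hg, map_sub, map_sub, hf, hk0, sub_zero]
  have key : ∀ k, g k = 0 := by
    intro k
    let G : (Fin d → Bool) → Fin m → Fin d → ℂ := fun σ b a => gv (k a) (σ a) b
    let c : (Fin d → Bool) → ℂ := fun σ => ∏ a, (sg (σ a) / 4)
    let lp : TK d d n := fun a => ((a, a), (k a).2)
    have hlp : ∀ v, ∑ a, wt (lp a) v = 2 := by
      intro v
      simp [lp, wt, Finset.sum_add_distrib]
    have hx : Pi.single k 1 - ∑ σ, c σ • (TG d n (G σ)).mulVec (Pi.single lp 1)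
        ∈ lowT d m n B := by
      rw [mem_lowT]
      have : qm d m n (Pi.single k 1 - ∑ σ, c σ • (TG d n (G σ)).mulVec (Pi.single lp 1)) = 0 := by
        rw [map_sub, map_sum, sub_eq_zero, qm_single, one_smul]
        have e : ∀ σ, qm d m n (c σ • (TG d n (G σ)).mulVec (Pi.single lp 1)) =
            ∏ a, (sg (σ a) / 4) • ∑ b, ∑ b', C (gv (k a) (σ a) b * gv (k a) (σ a) b') *
              (yv s(b, b') (k a).2 : MvPolynomial (PermIdx m n) ℂ) := by
          intro σ
          rw [map_smul, q_TG, qm_single, one_smul, map_prod, Finset.prod_smul]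
          congr 1
          refine Finset.prod_congr rfl fun a _ => ?_
          rw [ye, phi_yv]
        simp only [e]
        rw [Finset.prod_congr rfl fun a _ => polar (k a), Finset.prod_univ_sum,
          Fintype.piFinset_univ]
      rw [this]
      exact Ideal.zero_mem _
    have h1 := horth _ hx
    have h2 : ∀ σ, star ((TG d n (G σ)).mulVec (Pi.single lp 1)) ⬝ᵥ g = 0 := by
      intro σ
      rw [← TG_adj (G σ) (fun b a => gv_star _ _ _)]
      have hz : ((TG d n fun a b => G σ b a).mulVec g) lp = 0 := by
        refine weight_zero hn hB hB' _ ?_ ?_ lp hlp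
        · rw [q_TG, psi_phi, hg0, map_zero]
        · intro x hx
          rw [TG_adj (G σ) (fun b a => gv_star _ _ _)]
          apply horth
          rw [mem_lowT] at hx ⊢
          rw [q_TG]
          exact phi_low _ _ hx
      rw [show (star (Pi.single lp 1) : TK d d n → ℂ) = Pi.single lp 1 by
        rw [← Pi.single_star, star_one], single_one_dotProduct, hz]
    rw [star_sub, sub_dotProduct, star_sum, sum_dotProduct, Finset.sum_eq_zero, sub_zero,
      ← Pi.single_star, star_one, single_one_dotProduct] at h1
    · exact h1
    · intro σ _
      rw [star_smul, smul_dotProduct, h2, smul_zero]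
  have : f = n0 := by
    rw [← sub_eq_zero]
    exact _root_.funext key
  rw [this]
  exact hn0

lemma homog_mem_range {d m n : ℕ} (f : MvPolynomial (PermIdx m n) ℂ) (hf : f.IsHomogeneous d) :
    ∃ t, qm d m n t = f := by
  rw [← LinearMap.mem_range]
  rw [f.as_sum]
  refine Submodule.sum_mem _ fun s hs => ?_
  have hd : s.degree = d := by
    have := hf (mem_support_iff.1 hs)
    exact (congrArg (fun F => F s) (Finsupp.degree_eq_weight_one (R := ℕ))).trans this
  rw [← mul_one (coeff s f), ← smul_eq_mul, ← smul_monomial]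
  refine Submodule.smul_mem _ _ ?_
  have hc : (Finsupp.toMultiset s).card = d := by
    rw [Finsupp.card_toMultiset, ← hd]; rfl
  obtain ⟨l, hl⟩ := Quot.exists_rep (Finsupp.toMultiset s)
  have hl : (l : Multiset (PermIdx m n)) = Finsupp.toMultiset s := hl
  rw [← hl, Multiset.coe_card] at hc
  subst hc
  refine ⟨Pi.single (fun a => (((l.get a).1.1.1, (l.get a).1.1.2),
    s((l.get a).1.2.1, (l.get a).1.2.2))) 1, ?_⟩
  rw [qm_single, one_smul]
  have h1 : ∀ a : Fin l.length, ye ((((l.get a).1.1.1, (l.get a).1.1.2),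
    s((l.get a).1.2.1, (l.get a).1.2.2)) : Edge m n) = X (l.get a) := by
    intro a
    rw [X_eq_yv]; rfl
  simp only [h1]
  have h2 : ((Finsupp.toMultiset s).map (X (R := ℂ))).prod = monomial s 1 := by
    rw [Finsupp.toMultiset_map, Finsupp.prod_toMultiset, Finsupp.prod_mapDomain_index_inj]
    · rw [monomial_eq]; simp
    · exact X_injective
  rw [← h2, ← hl, Multiset.map_coe, Multiset.prod_coe, ← List.prod_ofFn]
  congr 1
  conv_rhs => rw [← List.ofFn_get l, List.map_ofFn]
  rfl

lemma ker_le {m n B : ℕ} (hn : 1 ≤ n) (hB : 2 ≤ B) (hB' : 3 ≤ B ∨ n = 1) :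
    RingHom.ker (PsiBar m n) ≤ lowI m n B := by
  intro f hf
  rw [RingHom.mem_ker] at hf
  rw [← sum_homogeneousComponent f]
  refine Ideal.sum_mem _ fun d _ => ?_
  have h0 : PsiBar m n (homogeneousComponent d f) = 0 := by
    have hp : ∀ w : PermIdx m n, (perm w).IsHomogeneous 2 := fun w =>
      ((isHomogeneous_X _ _).mul (isHomogeneous_X _ _)).add
        ((isHomogeneous_X _ _).mul (isHomogeneous_X _ _))
    have hh : ∀ e, (PsiBar m n (homogeneousComponent e f)).IsHomogeneous (2 * e) := fun e =>
      (homogeneousComponent_isHomogeneous e f).aeval (S := ℂ) perm hp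
    have h1 := congrArg (homogeneousComponent (2 * d)) hf
    conv_lhs at h1 => rw [← sum_homogeneousComponent f]
    rw [map_sum, map_sum, map_zero] at h1
    by_cases hd : d ∈ Finset.range (f.totalDegree + 1)
    · rw [Finset.sum_eq_single_of_mem d hd] at h1
      · rwa [homogeneousComponent_of_mem (hh d), if_pos rfl] at h1
      · intro e _ he
        rw [homogeneousComponent_of_mem (hh e), if_neg (by omega)]
    · rw [homogeneousComponent_eq_zero, map_zero]
      simpa using hd
  obtain ⟨t, ht⟩ := homog_mem_range _ (homogeneousComponent_isHomogeneous d f)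
  rw [← ht] at h0 ⊢
  exact main_lemma hn hB hB' t h0

end PermRel

/-- If `m ≥ n`, then `ker Ψ̄` is generated, as an ideal of `R̄`, by its homogeneous
elements of degree at most `⌊n/2⌋ + 2`. -/
theorem relations_permanents_generated_in_low_degree (m n : ℕ)
    (hn : 1 ≤ n) (hmn : n ≤ m) :
    RingHom.ker (PsiBar m n) =
      Ideal.span {f | f ∈ RingHom.ker (PsiBar m n) ∧
        ∃ d ≤ n / 2 + 2, f.IsHomogeneous d} := by
  have h := PermRel.ker_le (m := m) (n := n) (B := n / 2 + 2) hn (by omega) (by omega)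
  exact le_antisymm h (PermRel.lowI_le_ker m n _)
end
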